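/- Suppose (Poly-∞) and HK^h_U hold. Then there exist constants C≥1 and c,c′>0 such that for all (t,x,y)∈(0,∞)×D×D, writing r:=ρ(x,y): (i) if ψ(r) ≤ t, then C^{−1} h(1/φ^{−1}(1/t),x,y)/V(x,ψ^{−1}(t)) ≤ q(t,x,y) ≤ C h(1/φ^{−1}(1/t),x,y)/V(x,ψ^{−1}(t)); (ii) if ψ(r) ≥ t, then C^{−1}[ (C₀/(V(x,r)Ψ(r)))( t𝔅_h(t,x,y) + h(1/φ^{−1}(1/t),x,y)/φ^{−1}(1/t) ) + (h(1/φ^{−1}(1/t),x,y)/V(x,ψ^{−1}(t)))exp(−c r²/ψ^{−1}(t)²) + h(Φ(r),x,y)·t w(Φ(r))/V(x,r) ] ≤ q(t,x,y) ≤ C[ the same expression with c replaced by c′ ], where 𝔅_h(t,x,y):=∫_{2/φ^{−1}(1/t)}^{4Φ(r)} h(s,x,y)w(s)ds, ψ(r):=1/φ(1/Φ(r)) and ψ^{−1}(t)=Φ^{−1}(1/φ^{−1}(1/t)). -/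

import Mathlib

open MeasureTheory Real Set
open scoped ENNReal

/-- Tail of the Lévy measure: `w(r) = ν((r,∞))`. -/
noncomputable def levyTail (ν : Measure ℝ) (r : ℝ) : ℝ := (ν (Set.Ioi r)).toReal

/-- Laplace exponent `φ(λ) = ∫ (1 - e^{-λ s}) ν(ds)`. -/
noncomputable def laplaceExp (ν : Measure ℝ) (lam : ℝ) : ℝ :=
  ∫ s, (1 - Real.exp (-(lam * s))) ∂ν

/-- Condition (Poly-R₁); (Poly-∞) is the case `R₁ = ⊤`. -/
def PolyCond (ν : Measure ℝ) (R₁ : ℝ≥0∞) (c c' β₁ β₂ : ℝ) : Prop :=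
  ∀ r R : ℝ, 0 < r → r ≤ R → ENNReal.ofReal R < R₁ →
    c * (R / r) ^ β₁ ≤ levyTail ν r / levyTail ν R ∧
      levyTail ν r / levyTail ν R ≤ c' * (R / r) ^ β₂

/-- `ν` is the Lévy measure of a driftless subordinator. -/
structure IsLevyMeasure (ν : Measure ℝ) : Prop where
  supp : ν (Set.Iic 0) = 0
  tail_fin : ∀ r : ℝ, 0 < r → ν (Set.Ioi r) < ⊤
  integ : IntegrableOn (fun s => s) (Set.Ioc (0:ℝ) 1) ν

/-- `μ t` is the law of `S_t` for the driftless subordinator with Lévy measure `ν`. -/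
structure IsSubordinatorLaw (ν : Measure ℝ) (μ : ℝ → Measure ℝ) : Prop where
  levy : IsLevyMeasure ν
  prob : ∀ t : ℝ, 0 < t → IsProbabilityMeasure (μ t)
  nonneg : ∀ t : ℝ, 0 < t → μ t (Set.Iio 0) = 0
  laplace : ∀ t lam : ℝ, 0 < t → 0 ≤ lam →
    (∫ s, Real.exp (-(lam * s)) ∂(μ t)) = Real.exp (-(t * laplaceExp ν lam))

/-- `H(λ) = φ(λ) - λ φ'(λ)`. -/
noncomputable def Hfun (ν : Measure ℝ) (lam : ℝ) : ℝ :=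
  laplaceExp ν lam - lam * deriv (laplaceExp ν) lam

/-- `σ(t,s) = (φ')⁻¹(s/t)` if `s/t < φ'(0+)`, and `σ(t,s) = 0` otherwise. -/
def IsSigmaFun (ν : Measure ℝ) (σ : ℝ → ℝ → ℝ) : Prop :=
  ∀ t s : ℝ, 0 < t → 0 < s →
    ((∃ lam : ℝ, 0 < lam ∧ s / t < deriv (laplaceExp ν) lam) →
      0 < σ t s ∧ deriv (laplaceExp ν) (σ t s) = s / t) ∧
    ((∀ lam : ℝ, 0 < lam → deriv (laplaceExp ν) lam ≤ s / t) → σ t s = 0)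

/-- `φInv` is the inverse of the Laplace exponent `φ` on `(0,∞)`. -/
def IsPhiInv (ν : Measure ℝ) (φInv : ℝ → ℝ) : Prop :=
  ∀ u : ℝ, 0 < u → 0 < φInv u ∧ laplaceExp ν (φInv u) = u

/-- `HInv` is the inverse of `H` on `(0,∞)`. -/
def IsHInv (ν : Measure ℝ) (HInv : ℝ → ℝ) : Prop :=
  ∀ u : ℝ, 0 < u → 0 < HInv u ∧ Hfun ν (HInv u) = u

open Metric

/-- `V(x,r) = m(B(x,r))`. -/
noncomputable def vol {E : Type*} [PseudoMetricSpace E] [MeasurableSpace E] (m : Measure E) (x : E) (r : ℝ) : ℝ :=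
  (m (Metric.ball x r)).toReal

/-- Volume doubling and reverse doubling with exponents `d₁ ≤ d₂` and
localization radius `R_E`. -/
def VolDoubling {E : Type*} [PseudoMetricSpace E] [MeasurableSpace E] (m : Measure E) (R_E : ℝ≥0∞)
    (d₁ d₂ : ℝ) : Prop :=
  ∀ a : ℝ, 1 ≤ a → ∃ CV : ℝ, 1 ≤ CV ∧ ∀ (x : E) (r R : ℝ), 0 < r → r ≤ R →
    ENNReal.ofReal R < ENNReal.ofReal a * R_E →
    CV⁻¹ * (R / r) ^ d₁ ≤ vol m x R / vol m x r ∧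
      vol m x R / vol m x r ≤ CV * (R / r) ^ d₂

/-- Global weak scaling condition with indices `α₁ ≤ α₂`. -/
def WeakScaling (Φ : ℝ → ℝ) (c c' α₁ α₂ : ℝ) : Prop :=
  ∀ r R : ℝ, 0 < r → r ≤ R →
    c * (R / r) ^ α₁ ≤ Φ R / Φ r ∧ Φ R / Φ r ≤ c' * (R / r) ^ α₂

/-- `h` is a boundary function on `D`: it takes values in `[0,1]`, satisfies (H1)
(non-increasing in time) and (H2) with constant `cH` and exponent `γ` below the
time horizon `T` (`T = ⊤` for unbounded `D`). -/
def IsBoundaryFunction {E : Type*} (D : Set E) (h : ℝ → E → E → ℝ) (T : ℝ≥0∞)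
    (cH γ : ℝ) : Prop :=
  (∀ (t : ℝ) (x y : E), 0 < t → x ∈ D → y ∈ D → h t x y ∈ Set.Icc (0:ℝ) 1) ∧
  (∀ (x y : E), x ∈ D → y ∈ D → ∀ s t : ℝ, 0 < s → s ≤ t → h t x y ≤ h s x y) ∧
  (∀ (x y : E), x ∈ D → y ∈ D → ∀ s t : ℝ, 0 < s → s ≤ t → ENNReal.ofReal t < T →
    s ^ γ * h s x y ≤ cH * (t ^ γ * h t x y))

/-- Two-sided estimate (3.4) for the heat kernel `p_D` of `Y^D`, holding for all times
`t` with `0 < t` satisfying `tcond t`. -/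
def HKest {E : Type*} [PseudoMetricSpace E] [MeasurableSpace E] (m : Measure E) (D : Set E)
    (Ψ ΦInv : ℝ → ℝ) (h pD : ℝ → E → E → ℝ)
    (C₀ cl cexl cu cexu : ℝ) (tcond : ℝ → Prop) : Prop :=
  ∀ (t : ℝ) (x y : E), 0 < t → tcond t → x ∈ D → y ∈ D →
    cl * h t x y * min ((vol m x (ΦInv t))⁻¹)
        (C₀ * t / (vol m x (dist x y) * Ψ (dist x y)) +
          (vol m x (ΦInv t))⁻¹ * Real.exp (-(cexl * dist x y ^ 2 / ΦInv t ^ 2)))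
      ≤ pD t x y ∧
    pD t x y ≤ cu * h t x y * min ((vol m x (ΦInv t))⁻¹)
        (C₀ * t / (vol m x (dist x y) * Ψ (dist x y)) +
          (vol m x (ΦInv t))⁻¹ * Real.exp (-(cexu * dist x y ^ 2 / ΦInv t ^ 2)))

/-- Large-time estimate (3.5): `p_D(t,x,y) ≍ e^{-λ_D t} h(1,x,y)` for `t ≥ 1`. -/
def HKlarge {E : Type*} (D : Set E) (h pD : ℝ → E → E → ℝ) (lamD c₅ c₆ : ℝ) : Prop :=
  ∀ (t : ℝ) (x y : E), 1 ≤ t → x ∈ D → y ∈ D →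
    c₅ * Real.exp (-(lamD * t)) * h 1 x y ≤ pD t x y ∧
      pD t x y ≤ c₆ * Real.exp (-(lamD * t)) * h 1 x y

/-- Heat kernel `q(t,x,y) = ∫ p_D(s,x,y) P(S_t ∈ ds)` of the subordinate process. -/
noncomputable def subq {E : Type*} (μ : ℝ → Measure ℝ) (pD : ℝ → E → E → ℝ)
    (t : ℝ) (x y : E) : ℝ :=
  ∫ s, pD s x y ∂(μ t)

/-- Jump kernel `J(x,y) = ∫ p_D(s,x,y) ν(ds)` of the subordinate process. -/
noncomputable def subJ {E : Type*} (ν : Measure ℝ) (pD : ℝ → E → E → ℝ) (x y : E) : ℝ :=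
  ∫ s, pD s x y ∂ν

/-- Green function `G_D(x,y) = ∫_0^∞ q(t,x,y) dt` of the subordinate process. -/
noncomputable def subG {E : Type*} (μ : ℝ → Measure ℝ) (pD : ℝ → E → E → ℝ)
    (x y : E) : ℝ :=
  ∫ t in Set.Ioi (0:ℝ), subq μ pD t x y

/-- `ψ(r) = 1/φ(1/Φ(r))`. -/
noncomputable def psiFun (ν : Measure ℝ) (Φ : ℝ → ℝ) (r : ℝ) : ℝ :=
  (laplaceExp ν ((Φ r)⁻¹))⁻¹

/-- `𝔅_h(t,x,y) = ∫_{2/φ⁻¹(1/t)}^{4Φ(ρ(x,y))} h(s,x,y) w(s) ds`. -/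
noncomputable def sB {E : Type*} [PseudoMetricSpace E] [MeasurableSpace E] (ν : Measure ℝ)
    (h : ℝ → E → E → ℝ) (Φ φInv : ℝ → ℝ) (t : ℝ) (x y : E) : ℝ :=
  ∫ s in Set.Ioc (2 * (φInv (t⁻¹))⁻¹) (4 * Φ (dist x y)), h s x y * levyTail ν s

/-- Hypotheses of case (1): (Poly-R₁) holds and `HK^h_B` holds. -/
def BddCaseHyp {E : Type*} [PseudoMetricSpace E] [MeasurableSpace E] (m : Measure E) (D : Set E)
    (Φ Ψ ΦInv : ℝ → ℝ) (h pD : ℝ → E → E → ℝ) (ν : Measure ℝ)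
    (R₁ : ℝ≥0∞) (cw cw' β₁ β₂ cH γ C₀ cl cexl cu cexu : ℝ) : Prop :=
  PolyCond ν R₁ cw cw' β₁ β₂ ∧
  Bornology.IsBounded D ∧
  ENNReal.ofReal (8 * Φ (Metric.diam D)) < R₁ ∧
  IsBoundaryFunction D h (ENNReal.ofReal (4 * Φ (Metric.diam D) + 1)) cH γ ∧
  HKest m D Ψ ΦInv h pD C₀ cl cexl cu cexu (fun t => t ≤ 1) ∧
  ∃ lamD c₅ c₆ : ℝ, 0 < lamD ∧ 0 < c₅ ∧ 0 < c₆ ∧ HKlarge D h pD lamD c₅ c₆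

/-- Hypotheses of case (2): (Poly-∞) holds and `HK^h_U` holds (with `R_E = ⊤`). -/
def UnbddCaseHyp {E : Type*} [PseudoMetricSpace E] [MeasurableSpace E] (m : Measure E) (D : Set E)
    (Ψ ΦInv : ℝ → ℝ) (h pD : ℝ → E → E → ℝ) (ν : Measure ℝ)
    (R_E : ℝ≥0∞) (cw cw' β₁ β₂ cH γ C₀ cl cexl cu cexu : ℝ) : Prop :=
  PolyCond ν ⊤ cw cw' β₁ β₂ ∧
  R_E = ⊤ ∧
  IsBoundaryFunction D h ⊤ cH γ ∧
  HKest m D Ψ ΦInv h pD C₀ cl cexl cu cexu (fun _ => True)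

/-- On-diagonal expression `h(1/φ⁻¹(1/t),x,y) / V(x, ψ⁻¹(t))`. -/
noncomputable def onDiag {E : Type*} [PseudoMetricSpace E] [MeasurableSpace E] (m : Measure E)
    (h : ℝ → E → E → ℝ) (ΦInv φInv : ℝ → ℝ) (t : ℝ) (x y : E) : ℝ :=
  h ((φInv (t⁻¹))⁻¹) x y / vol m x (ΦInv ((φInv (t⁻¹))⁻¹))

/-- Off-diagonal expression in Theorem 4.2(ii), with constant `c` in the exponential. -/
noncomputable def offDiag {E : Type*} [PseudoMetricSpace E] [MeasurableSpace E] (ν : Measure ℝ)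
    (m : Measure E) (h : ℝ → E → E → ℝ) (Φ Ψ ΦInv φInv : ℝ → ℝ)
    (C₀ c t : ℝ) (x y : E) : ℝ :=
  C₀ / (vol m x (dist x y) * Ψ (dist x y)) *
      (t * sB ν h Φ φInv t x y + h ((φInv (t⁻¹))⁻¹) x y / φInv (t⁻¹)) +
    h ((φInv (t⁻¹))⁻¹) x y / vol m x (ΦInv ((φInv (t⁻¹))⁻¹)) *
      Real.exp (-(c * dist x y ^ 2 / ΦInv ((φInv (t⁻¹))⁻¹) ^ 2)) +
    h (Φ (dist x y)) x y * (t * levyTail ν (Φ (dist x y))) / vol m x (dist x y)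



/-! ## Laplace uniqueness -/

theorem aux_complexMGF_series (P : Measure ℝ) [IsProbabilityMeasure P] (hP : P (Set.Iio 0) = 0)
    (z : ℂ) :
    HasSum (fun n : ℕ => z ^ n / (n.factorial : ℂ) * ((∫ s, Real.exp (-((n:ℝ) * s)) ∂P : ℝ) : ℂ))
      (ProbabilityTheory.complexMGF (fun s => Real.exp (-s)) P z) := by
  have hae : ∀ᵐ s ∂P, 0 ≤ s := by
    rw [ae_iff]; simpa [not_le, Set.Iio] using hP
  have key := hasSum_integral_of_dominated_convergence (μ := P)
    (F := fun (n : ℕ) (s : ℝ) => z ^ n / (n.factorial : ℂ) * ((Real.exp (-((n:ℝ) * s)) : ℝ) : ℂ))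
    (f := fun s => Complex.exp (z * ((Real.exp (-s) : ℝ) : ℂ)))
    (bound := fun n _ => ‖z‖ ^ n / (n.factorial : ℝ)) ?_ ?_ ?_ ?_ ?_
  · have e : (fun n : ℕ => z ^ n / (n.factorial : ℂ) *
        ((∫ s, Real.exp (-((n:ℝ) * s)) ∂P : ℝ) : ℂ)) = fun n : ℕ =>
        ∫ a : ℝ, z ^ n / (n.factorial : ℂ) * ((Real.exp (-((n:ℝ) * a)) : ℝ) : ℂ) ∂P := by
      funext n
      rw [integral_const_mul, integral_complex_ofReal]
    rw [e]
    exact key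
  · intro n; fun_prop
  · intro n
    filter_upwards [hae] with s hs
    rw [norm_mul, norm_div, norm_pow, Complex.norm_natCast, Complex.norm_real,
      Real.norm_of_nonneg (Real.exp_pos _).le]
    have : Real.exp (-((n:ℝ) * s)) ≤ 1 := by
      rw [Real.exp_le_one_iff]; have : 0 ≤ (n:ℝ) * s := by positivity
      linarith
    have h2 : 0 ≤ ‖z‖ ^ n / (n.factorial : ℝ) := by positivity
    nlinarith
  · exact Filter.Eventually.of_forall fun s => Real.summable_pow_div_factorial ‖z‖
  · exact integrable_const _
  · refine Filter.Eventually.of_forall fun s => ?_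
    have := NormedSpace.expSeries_div_hasSum_exp (𝔸 := ℂ) (z * ((Real.exp (-s) : ℝ) : ℂ))
    rw [← Complex.exp_eq_exp_ℂ] at this
    have e : (fun n : ℕ => z ^ n / (n.factorial : ℂ) * ((Real.exp (-((n:ℝ) * s)) : ℝ) : ℂ))
        = fun n : ℕ => (z * ((Real.exp (-s) : ℝ) : ℂ)) ^ n / (n.factorial : ℂ) := by
      funext n
      rw [mul_pow, ← Complex.ofReal_pow, ← Real.exp_nat_mul]
      ring_nf
    simp only [e]
    exact this

theorem aux_laplace_unique (P P' : Measure ℝ) [IsProbabilityMeasure P] [IsProbabilityMeasure P']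
    (hP : P (Set.Iio 0) = 0) (hP' : P' (Set.Iio 0) = 0)
    (hL : ∀ lam : ℝ, 0 ≤ lam → ∫ s, Real.exp (-(lam * s)) ∂P = ∫ s, Real.exp (-(lam * s)) ∂P') :
    P = P' := by
  have h1 : ProbabilityTheory.complexMGF (fun s => Real.exp (-s)) P
      = ProbabilityTheory.complexMGF (fun s => Real.exp (-s)) P' := by
    funext z
    refine (aux_complexMGF_series P hP z).unique ?_
    convert aux_complexMGF_series P' hP' z using 4 with n
    exact hL n (by positivity)
  have h2 := Measure.ext_of_complexMGF_eq (μ := P) (μ' := P') (by fun_prop) (by fun_prop) h1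
  have h3 := congrArg (fun M => Measure.map (fun u => - Real.log u) M) h2
  rw [Measure.map_map (by fun_prop) (by fun_prop), Measure.map_map (by fun_prop) (by fun_prop)] at h3
  have h4 : ((fun u => - Real.log u) ∘ fun s : ℝ => Real.exp (-s)) = id := by
    funext s; simp
  rw [h4, Measure.map_id, Measure.map_id] at h3
  exact h3

/-- `μ t` is the law of a sum of `n` iid variables with law `μ (t/n)`. -/
theorem aux_pi_sum {ν : Measure ℝ} {μ : ℝ → Measure ℝ} (hsub : IsSubordinatorLaw ν μ)
    (t : ℝ) (ht : 0 < t) (n : ℕ) (hn : 0 < n) :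
    μ t = (Measure.pi (fun _ : Fin n => μ (t / n))).map (fun x => ∑ i, x i) := by
  have hn' : (0:ℝ) < n := by exact_mod_cast hn
  have htn : 0 < t / n := by positivity
  have := hsub.prob t ht
  have := hsub.prob _ htn
  have hmeas : Measurable (fun x : Fin n → ℝ => ∑ i, x i) := by fun_prop
  have : IsProbabilityMeasure ((Measure.pi (fun _ : Fin n => μ (t / n))).map
    (fun x => ∑ i, x i)) := Measure.isProbabilityMeasure_map hmeas.aemeasurable
  refine aux_laplace_unique _ _ (hsub.nonneg t ht) ?_ ?_
  · rw [Measure.map_apply hmeas measurableSet_Iio]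
    have hae : ∀ᵐ x ∂(Measure.pi (fun _ : Fin n => μ (t / n))), ∀ i, 0 ≤ x i := by
      rw [ae_all_iff]
      intro i
      have : ∀ᵐ s ∂(μ (t / n)), 0 ≤ s := by
        rw [ae_iff]; simpa [not_le, Set.Iio] using hsub.nonneg _ htn
      exact (measurePreserving_eval (fun _ : Fin n => μ (t / n)) i).quasiMeasurePreserving.ae this
    have : ∀ᵐ x ∂(Measure.pi (fun _ : Fin n => μ (t / n))), 0 ≤ ∑ i, x i := by
      filter_upwards [hae] with x hx
      exact Finset.sum_nonneg fun i _ => hx i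
    rw [ae_iff] at this
    simp only [not_le] at this
    exact this
  · intro lam hlam
    rw [hsub.laplace t lam ht hlam, integral_map hmeas.aemeasurable (by fun_prop)]
    have : ∀ x : Fin n → ℝ, Real.exp (-(lam * ∑ i, x i)) = ∏ i, Real.exp (-(lam * x i)) := by
      intro x
      rw [← Real.exp_sum, Finset.mul_sum, Finset.sum_neg_distrib]
    simp_rw [this]
    rw [integral_fintype_prod_eq_pow (fun s : ℝ => Real.exp (-(lam * s))),
      hsub.laplace _ lam htn hlam, Fintype.card_fin, ← Real.exp_nat_mul]
    congr 1
    field_simp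


/-! ## Facts on the Lévy measure -/

theorem aux_w_pos {ν : Measure ℝ} {cw cw' β₁ β₂ : ℝ} (hcw : 0 < cw)
    (hpoly : PolyCond ν ⊤ cw cw' β₁ β₂) (r : ℝ) (hr : 0 < r) : 0 < levyTail ν r := by
  have h := (hpoly r r hr le_rfl ENNReal.ofReal_lt_top).1
  rw [div_self hr.ne', Real.one_rpow] at h
  have h0 : 0 ≤ levyTail ν r := ENNReal.toReal_nonneg
  rcases h0.lt_or_eq with h1 | h1
  · exact h1
  · rw [← h1] at h; simp at h; linarith

theorem aux_w_upper {ν : Measure ℝ} {cw cw' β₁ β₂ : ℝ} (hcw : 0 < cw)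
    (hpoly : PolyCond ν ⊤ cw cw' β₁ β₂) (r R : ℝ) (hr : 0 < r) (hR : r ≤ R) :
    levyTail ν r ≤ cw' * (R / r) ^ β₂ * levyTail ν R := by
  have h := (hpoly r R hr hR ENNReal.ofReal_lt_top).2
  rwa [div_le_iff₀ (aux_w_pos hcw hpoly R (hr.trans_le hR))] at h

theorem aux_w_lower {ν : Measure ℝ} {cw cw' β₁ β₂ : ℝ} (hcw : 0 < cw)
    (hpoly : PolyCond ν ⊤ cw cw' β₁ β₂) (r R : ℝ) (hr : 0 < r) (hR : r ≤ R) :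
    cw * (R / r) ^ β₁ * levyTail ν R ≤ levyTail ν r := by
  have h := (hpoly r R hr hR ENNReal.ofReal_lt_top).1
  rwa [le_div_iff₀ (aux_w_pos hcw hpoly R (hr.trans_le hR))] at h

theorem aux_w_anti {ν : Measure ℝ} (hν : IsLevyMeasure ν) (r R : ℝ) (hr : 0 < r) (hR : r ≤ R) :
    levyTail ν R ≤ levyTail ν r :=
  ENNReal.toReal_mono (hν.tail_fin r hr).ne (measure_mono (Set.Ioi_subset_Ioi hR))

theorem aux_w_ofReal {ν : Measure ℝ} (hν : IsLevyMeasure ν) (r : ℝ) (hr : 0 < r) :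
    ν (Set.Ioi r) = ENNReal.ofReal (levyTail ν r) :=
  (ENNReal.ofReal_toReal (hν.tail_fin r hr).ne).symm

theorem aux_w_meas (ν : Measure ℝ) : Measurable (levyTail ν) := by
  have : Antitone (fun r => ν (Set.Ioi r)) := fun a b hab => measure_mono (Set.Ioi_subset_Ioi hab)
  exact this.measurable.ennreal_toReal

theorem aux_nu_ae {ν : Measure ℝ} (hν : IsLevyMeasure ν) : ∀ᵐ s ∂ν, 0 < s := by
  rw [ae_iff]; simpa [not_lt, Set.Iic] using hν.supp

theorem aux_one_sub_exp_nonneg (x : ℝ) (hx : 0 ≤ x) : 0 ≤ 1 - Real.exp (-x) := by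
  have : Real.exp (-x) ≤ 1 := by rw [Real.exp_le_one_iff]; linarith
  linarith

theorem aux_one_sub_exp_le (x : ℝ) : 1 - Real.exp (-x) ≤ x := by
  have := Real.add_one_le_exp (-x); linarith

theorem aux_one_sub_exp_le_one (x : ℝ) : 1 - Real.exp (-x) ≤ 1 := by
  have := Real.exp_pos (-x); linarith

theorem aux_phi_int {ν : Measure ℝ} (hν : IsLevyMeasure ν) (lam : ℝ) (hl : 0 ≤ lam) :
    Integrable (fun s => 1 - Real.exp (-(lam * s))) ν := by
  have h1 : IntegrableOn (fun s => 1 - Real.exp (-(lam * s))) (Set.Ioc 0 1) ν := by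
    refine Integrable.mono' (hν.integ.const_mul lam) (by fun_prop) ?_
    refine (ae_restrict_iff' measurableSet_Ioc).2 (Filter.Eventually.of_forall fun s hs => ?_)
    rw [Real.norm_of_nonneg (aux_one_sub_exp_nonneg _ (mul_nonneg hl hs.1.le))]
    exact aux_one_sub_exp_le _
  have h2 : IntegrableOn (fun s => 1 - Real.exp (-(lam * s))) (Set.Ioi 1) ν := by
    have : IntegrableOn (fun _ : ℝ => (1:ℝ)) (Set.Ioi 1) ν :=
      integrableOn_const (hs := (hν.tail_fin 1 one_pos).ne) 
    refine Integrable.mono' this (by fun_prop) ?_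
    refine (ae_restrict_iff' measurableSet_Ioi).2 (Filter.Eventually.of_forall fun s hs => ?_)
    have hs' : (0:ℝ) ≤ s := by have := Set.mem_Ioi.1 hs; linarith
    rw [Real.norm_of_nonneg (aux_one_sub_exp_nonneg _ (mul_nonneg hl hs'))]
    exact aux_one_sub_exp_le_one _
  have h3 : IntegrableOn (fun s => 1 - Real.exp (-(lam * s))) (Set.Iic 0) ν := by
    rw [IntegrableOn, Measure.restrict_eq_zero.2 hν.supp]
    exact integrable_zero_measure
  have := (h3.union h1).union h2
  rwa [Set.Iic_union_Ioc_eq_Iic zero_le_one, Set.Iic_union_Ioi, integrableOn_univ] at this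

theorem aux_phi_zero (ν : Measure ℝ) : laplaceExp ν 0 = 0 := by simp [laplaceExp]

theorem aux_phi_mono {ν : Measure ℝ} (hν : IsLevyMeasure ν) (a b : ℝ) (ha : 0 ≤ a) (hab : a ≤ b) :
    laplaceExp ν a ≤ laplaceExp ν b := by
  refine integral_mono_ae (aux_phi_int hν a ha) (aux_phi_int hν b (ha.trans hab)) ?_
  filter_upwards [aux_nu_ae hν] with s hs
  have : Real.exp (-(b * s)) ≤ Real.exp (-(a * s)) := by
    apply Real.exp_le_exp.2; nlinarith
  linarith

theorem aux_phi_smul {ν : Measure ℝ} (hν : IsLevyMeasure ν) (a b : ℝ) (ha : 1 ≤ a) (hb : 0 ≤ b) :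
    laplaceExp ν (a * b) ≤ a * laplaceExp ν b := by
  unfold laplaceExp
  rw [← integral_const_mul]
  refine integral_mono_ae (aux_phi_int hν _ (by positivity)) ((aux_phi_int hν b hb).const_mul a) ?_
  filter_upwards [aux_nu_ae hν] with s hs
  have h := one_add_mul_self_le_rpow_one_add (s := Real.exp (-(b * s)) - 1)
    (by linarith [Real.exp_pos (-(b*s))]) ha
  have e : (1 + (Real.exp (-(b * s)) - 1)) ^ a = Real.exp (-(a * b * s)) := by
    rw [add_sub_cancel, ← Real.exp_mul]; ring_nf
  rw [e] at h
  linarith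

theorem aux_w_le_phi {ν : Measure ℝ} (hν : IsLevyMeasure ν) (b : ℝ) (hb : 0 < b) :
    levyTail ν b ≤ 2 * laplaceExp ν b⁻¹ := by
  have h1 : ∫ s, (Set.Ioi b).indicator (fun _ => (1:ℝ)) s ∂ν
      ≤ ∫ s, 2 * (1 - Real.exp (-(b⁻¹ * s))) ∂ν := by
    refine integral_mono_ae ?_ ((aux_phi_int hν _ (by positivity)).const_mul 2) ?_
    · rw [integrable_indicator_iff measurableSet_Ioi]
      exact integrableOn_const (hs := (hν.tail_fin b hb).ne)
    · filter_upwards [aux_nu_ae hν] with s hs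
      by_cases hsb : s ∈ Set.Ioi b
      · rw [Set.indicator_of_mem hsb]
        have h1 : 1 ≤ b⁻¹ * s := by
          rw [inv_mul_eq_div, le_div_iff₀ hb]; have := Set.mem_Ioi.1 hsb; linarith
        have : Real.exp (-(b⁻¹ * s)) ≤ Real.exp (-1) := by apply Real.exp_le_exp.2; linarith
        have := Real.exp_neg_one_lt_half
        linarith
      · rw [Set.indicator_of_notMem hsb]
        have := aux_one_sub_exp_nonneg (b⁻¹ * s) (by positivity)
        linarith
  rw [integral_indicator measurableSet_Ioi, integral_const_mul] at h1
  simpa [levyTail, laplaceExp, Measure.real] using h1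

theorem aux_phi_pos {ν : Measure ℝ} {cw cw' β₁ β₂ : ℝ} (hν : IsLevyMeasure ν) (hcw : 0 < cw)
    (hpoly : PolyCond ν ⊤ cw cw' β₁ β₂) (a : ℝ) (ha : 0 < a) : 0 < laplaceExp ν a := by
  have h1 := aux_w_le_phi hν a⁻¹ (by positivity)
  have h2 := aux_w_pos hcw hpoly a⁻¹ (by positivity)
  rw [inv_inv] at h1
  linarith

theorem aux_phi_lintegral {ν : Measure ℝ} (hν : IsLevyMeasure ν) (a : ℝ) (ha : 0 ≤ a) :
    ENNReal.ofReal (laplaceExp ν a) = ∫⁻ u in Set.Ioi 0, ν {s | u < 1 - Real.exp (-(a * s))} := by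
  have hnn : 0 ≤ᵐ[ν] fun s => 1 - Real.exp (-(a * s)) := by
    filter_upwards [aux_nu_ae hν] with s hs
    exact aux_one_sub_exp_nonneg _ (by positivity)
  rw [laplaceExp, ofReal_integral_eq_lintegral_ofReal (aux_phi_int hν a ha) hnn,
    lintegral_eq_lintegral_meas_lt _ hnn (by fun_prop)]

theorem aux_phi_double {ν : Measure ℝ} {cw cw' β₁ β₂ : ℝ} (hν : IsLevyMeasure ν) (hcw : 0 < cw)
    (hβ₁ : 0 < β₁) (hpoly : PolyCond ν ⊤ cw cw' β₁ β₂) :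
    ∃ K : ℝ, 2 ≤ K ∧ ∀ a : ℝ, 0 < a → 2 * laplaceExp ν a ≤ laplaceExp ν (K * a) := by
  obtain ⟨K, hK2, hK⟩ : ∃ K : ℝ, 2 ≤ K ∧ 2 ≤ cw * K ^ β₁ := by
    have h := ((tendsto_rpow_atTop hβ₁).const_mul_atTop hcw).eventually_ge_atTop 2
    obtain ⟨K, h1, h2⟩ := (h.and (Filter.eventually_ge_atTop 2)).exists
    exact ⟨K, h2, h1⟩
  refine ⟨K, hK2, fun a ha => ?_⟩
  have hK0 : 0 < K := by linarith
  have hpos : ∀ b, 0 ≤ b → 0 ≤ laplaceExp ν b := fun b hb => by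
    have := aux_phi_mono hν 0 b le_rfl hb; rwa [aux_phi_zero] at this
  have hset : ∀ b : ℝ, 0 < b → ∀ u ∈ Set.Ioi (0:ℝ), u < 1 →
      {s | u < 1 - Real.exp (-(b * s))} = Set.Ioi (-Real.log (1 - u) / b) := by
    intro b hb u hu hu1
    ext s
    simp only [Set.mem_ofPred_eq, Set.mem_Ioi]
    rw [div_lt_iff₀ hb, neg_lt, ← mul_comm b s]
    rw [Real.lt_log_iff_exp_lt (by linarith)]
    constructor <;> intro h <;> linarith
  have : ENNReal.ofReal (2 * laplaceExp ν a) ≤ ENNReal.ofReal (laplaceExp ν (K * a)) := by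
    rw [ENNReal.ofReal_mul (by norm_num), aux_phi_lintegral hν a ha.le,
      aux_phi_lintegral hν (K * a) (by positivity), ← lintegral_const_mul' _ _ (by simp)]
    refine setLIntegral_mono' measurableSet_Ioi fun u hu => ?_
    by_cases hu1 : u < 1
    · rw [hset a ha u hu hu1, hset (K * a) (by positivity) u hu hu1]
      set v := -Real.log (1 - u) / a with hv
      have hv0 : 0 < v := by
        have : Real.log (1 - u) < 0 := Real.log_neg (by linarith) (by have := Set.mem_Ioi.1 hu; linarith)
        apply div_pos (by linarith) ha
      have e : -Real.log (1 - u) / (K * a) = v / K := by rw [hv]; field_simp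
      rw [e, aux_w_ofReal hν v hv0, aux_w_ofReal hν (v / K) (by positivity),
        ← ENNReal.ofReal_mul (by norm_num)]
      apply ENNReal.ofReal_le_ofReal
      have h1 := aux_w_lower hcw hpoly (v / K) v (by positivity) (div_le_self hv0.le (by linarith))
      have e2 : v / (v / K) = K := by field_simp
      rw [e2] at h1
      have h2 := aux_w_pos hcw hpoly v hv0
      nlinarith
    · have : {s | u < 1 - Real.exp (-(a * s))} = ∅ := by
        ext s
        simp only [Set.mem_ofPred_eq, Set.mem_empty_iff_false, iff_false, not_lt]
        have := Real.exp_pos (-(a * s)); linarith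
      rw [this]; simp
  exact (ENNReal.ofReal_le_ofReal_iff (hpos _ (by positivity))).1 this

theorem aux_phi_double_iter {ν : Measure ℝ} {K : ℝ} (hK2 : 2 ≤ K)
    (hK : ∀ a : ℝ, 0 < a → 2 * laplaceExp ν a ≤ laplaceExp ν (K * a)) (j : ℕ) (a : ℝ) (ha : 0 < a) :
    2 ^ j * laplaceExp ν a ≤ laplaceExp ν (K ^ j * a) := by
  induction j with
  | zero => simp
  | succ j ih =>
    have := hK (K ^ j * a) (by positivity)
    rw [pow_succ', pow_succ', mul_assoc, mul_assoc]
    linarith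

/-- dyadic decomposition -/
theorem aux_dyadic (β : ℝ) (k : ℕ) (hk : β < k) : ∃ C : ℝ, 0 < C ∧
    ∀ (M : Measure ℝ) (b A : ℝ), 0 < b → 0 ≤ A →
      (∀ u, 0 < u → u ≤ b → M (Set.Ioi u) ≤ ENNReal.ofReal (A * (b / u) ^ β)) →
      ∫⁻ s in Set.Ioi 0, ENNReal.ofReal ((min 1 (s / b)) ^ k) ∂M ≤ ENNReal.ofReal (C * A) := by
  set q : ℝ := (1/2) ^ k * 2 ^ β with hq
  have hq0 : 0 < q := by positivity
  have hq1 : q < 1 := by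
    have : q = 2 ^ (β - k) := by
      rw [hq, Real.rpow_sub (by norm_num), Real.rpow_natCast, one_div, inv_pow]; ring
    rw [this]
    exact Real.rpow_lt_one_of_one_lt_of_neg (by norm_num) (by linarith)
  refine ⟨2 ^ β * (1 - q)⁻¹, mul_pos (by positivity) (inv_pos.2 (by linarith)), ?_⟩
  intro M b A hb hA hM
  have hpt : ∀ s ∈ Set.Ioi (0:ℝ), ENNReal.ofReal ((min 1 (s / b)) ^ k) ≤
      ∑' j : ℕ, (Set.Ioi (b * (1/2) ^ (j+1))).indicator
        (fun _ => ENNReal.ofReal (((1/2 : ℝ) ^ k) ^ j)) s := by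
    intro s hs
    have hs0 : 0 < s := hs
    have hx : 0 < min 1 (s / b) := lt_min one_pos (by positivity)
    obtain ⟨j, hj1, hj2⟩ := exists_nat_pow_near_of_lt_one hx (min_le_left _ _)
      (y := (1/2 : ℝ)) (by norm_num) (by norm_num)
    refine le_trans ?_ (ENNReal.le_tsum j)
    have hmem : s ∈ Set.Ioi (b * (1/2 : ℝ) ^ (j+1)) := by
      have := hj1.trans_le (min_le_right _ _)
      rw [lt_div_iff₀ hb] at this
      rw [Set.mem_Ioi]; linarith
    rw [Set.indicator_of_mem hmem]
    apply ENNReal.ofReal_le_ofReal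
    rw [← pow_mul, mul_comm k j, pow_mul]
    exact pow_le_pow_left₀ hx.le hj2 k
  calc ∫⁻ s in Set.Ioi 0, ENNReal.ofReal ((min 1 (s / b)) ^ k) ∂M
      ≤ ∫⁻ s in Set.Ioi 0, ∑' j : ℕ, (Set.Ioi (b * (1/2) ^ (j+1))).indicator
        (fun _ => ENNReal.ofReal (((1/2 : ℝ) ^ k) ^ j)) s ∂M := setLIntegral_mono' measurableSet_Ioi hpt
    _ ≤ ∫⁻ s, ∑' j : ℕ, (Set.Ioi (b * (1/2) ^ (j+1))).indicator
        (fun _ => ENNReal.ofReal (((1/2 : ℝ) ^ k) ^ j)) s ∂M := setLIntegral_le_lintegral _ _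
    _ = ∑' j : ℕ, ENNReal.ofReal (((1/2 : ℝ) ^ k) ^ j) * M (Set.Ioi (b * (1/2) ^ (j+1))) := by
        rw [lintegral_tsum]
        · congr 1; funext j
          rw [lintegral_indicator_const measurableSet_Ioi]
        · intro j
          exact (measurable_const.indicator measurableSet_Ioi).aemeasurable
    _ ≤ ∑' j : ℕ, ENNReal.ofReal (A * 2 ^ β * q ^ j) := by
        refine ENNReal.tsum_le_tsum fun j => ?_
        have h1 := hM (b * (1/2) ^ (j+1)) (by positivity)
          (mul_le_of_le_one_right hb.le (pow_le_one₀ (by norm_num) (by norm_num)))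
        refine (mul_le_mul_right h1 _).trans ?_
        rw [← ENNReal.ofReal_mul (by positivity)]
        apply ENNReal.ofReal_le_ofReal
        have e : b / (b * (1/2) ^ (j+1)) = 2 ^ (j+1) := by
          rw [one_div, inv_pow]; field_simp
        rw [e, ← Real.rpow_natCast 2 (j+1), ← Real.rpow_mul (by norm_num), mul_comm _ β,
          Real.rpow_mul (by norm_num), Real.rpow_natCast, hq, pow_succ, mul_pow]
        apply le_of_eq; ring
    _ = ENNReal.ofReal (2 ^ β * (1 - q)⁻¹ * A) := by
        rw [← ENNReal.ofReal_tsum_of_nonneg (fun j => by positivity)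
          ((summable_geometric_of_lt_one hq0.le hq1).mul_left _), tsum_mul_left,
          tsum_geometric_of_lt_one hq0.le hq1]
        congr 1; ring

theorem aux_gk_int {ν : Measure ℝ} (hν : IsLevyMeasure ν) (lam : ℝ) (hl : 0 ≤ lam) (k : ℕ)
    (hk : 1 ≤ k) : Integrable (fun s => (1 - Real.exp (-(lam * s))) ^ k) ν := by
  refine Integrable.mono' (aux_phi_int hν lam hl) (by fun_prop) ?_
  filter_upwards [aux_nu_ae hν] with s hs
  have h0 := aux_one_sub_exp_nonneg (lam * s) (by positivity)
  rw [Real.norm_of_nonneg (by positivity)]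
  exact pow_le_of_le_one h0 (aux_one_sub_exp_le_one _) (by omega)

theorem aux_gk_upper {ν : Measure ℝ} {cw cw' β₁ β₂ : ℝ} (hν : IsLevyMeasure ν) (hcw : 0 < cw)
    (hcw' : 0 < cw') (hpoly : PolyCond ν ⊤ cw cw' β₁ β₂) (k : ℕ) (hk : β₂ < k) :
    ∃ C : ℝ, 0 < C ∧ ∀ b : ℝ, 0 < b →
      ∫ s, (1 - Real.exp (-(b⁻¹ * s))) ^ k ∂ν ≤ C * levyTail ν b := by
  obtain ⟨C, hC, hdy⟩ := aux_dyadic β₂ k hk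
  refine ⟨C * cw', by positivity, fun b hb => ?_⟩
  have hw := aux_w_pos hcw hpoly b hb
  have h1 := hdy ν b (cw' * levyTail ν b) hb (by positivity) (fun u hu hub => by
    rw [aux_w_ofReal hν u hu]
    apply ENNReal.ofReal_le_ofReal
    have := aux_w_upper hcw hpoly u b hu hub
    linarith)
  have hnn : 0 ≤ᵐ[ν] fun s => (1 - Real.exp (-(b⁻¹ * s))) ^ k := by
    filter_upwards [aux_nu_ae hν] with s hs
    exact pow_nonneg (aux_one_sub_exp_nonneg _ (by positivity)) k
  rw [integral_eq_lintegral_of_nonneg_ae hnn (by fun_prop), mul_assoc]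
  refine ENNReal.toReal_le_of_le_ofReal (by positivity) (le_trans ?_ h1)
  have e : ν.restrict (Set.Ioi 0) = ν := Measure.restrict_eq_self_of_ae_mem (aux_nu_ae hν)
  rw [e]
  refine lintegral_mono_ae ?_
  filter_upwards [aux_nu_ae hν] with s hs
  apply ENNReal.ofReal_le_ofReal
  refine pow_le_pow_left₀ (aux_one_sub_exp_nonneg _ (by positivity)) ?_ k
  refine le_min (aux_one_sub_exp_le_one _) ?_
  rw [div_eq_inv_mul]; exact aux_one_sub_exp_le _

theorem aux_gk_lower {ν : Measure ℝ} (hν : IsLevyMeasure ν) (k : ℕ) (hk1 : 1 ≤ k) (b : ℝ)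
    (hb : 0 < b) : (1/2) ^ k * levyTail ν b ≤ ∫ s, (1 - Real.exp (-(b⁻¹ * s))) ^ k ∂ν := by
  have h1 : ∫ s, (Set.Ioi b).indicator (fun _ => (1/2:ℝ)^k) s ∂ν
      ≤ ∫ s, (1 - Real.exp (-(b⁻¹ * s)))^k ∂ν := by
    refine integral_mono_ae ?_ (aux_gk_int hν _ (by positivity) k hk1) ?_
    · rw [integrable_indicator_iff measurableSet_Ioi]
      exact integrableOn_const (hs := (hν.tail_fin b hb).ne)
    · filter_upwards [aux_nu_ae hν] with s hs
      by_cases hsb : s ∈ Set.Ioi b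
      · rw [Set.indicator_of_mem hsb]
        have h1 : 1 ≤ b⁻¹ * s := by
          rw [inv_mul_eq_div, le_div_iff₀ hb]; have := Set.mem_Ioi.1 hsb; linarith
        have : Real.exp (-(b⁻¹ * s)) ≤ Real.exp (-1) := by apply Real.exp_le_exp.2; linarith
        have := Real.exp_neg_one_lt_half
        exact pow_le_pow_left₀ (by norm_num) (by linarith) k
      · rw [Set.indicator_of_notMem hsb]
        have := aux_one_sub_exp_nonneg (b⁻¹ * s) (by positivity)
        positivity
  rw [integral_indicator measurableSet_Ioi] at h1
  simpa [levyTail, Measure.real, mul_comm] using h1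


/-! ## Basic facts on the subordinator law -/

section law
variable {ν : Measure ℝ} {μ : ℝ → Measure ℝ}

theorem aux_mu_ae (hsub : IsSubordinatorLaw ν μ) (t : ℝ) (ht : 0 < t) : ∀ᵐ s ∂(μ t), 0 ≤ s := by
  rw [ae_iff]; simpa [not_le, Set.Iio] using hsub.nonneg t ht

theorem aux_lap_int (hsub : IsSubordinatorLaw ν μ) (t : ℝ) (ht : 0 < t) (lam : ℝ) (hl : 0 ≤ lam) :
    Integrable (fun s => Real.exp (-(lam * s))) (μ t) := by
  have := hsub.prob t ht
  refine Integrable.mono' (integrable_const (1:ℝ)) (by fun_prop) ?_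
  filter_upwards [aux_mu_ae hsub t ht] with s hs
  rw [Real.norm_of_nonneg (Real.exp_pos _).le, Real.exp_le_one_iff]
  have : 0 ≤ lam * s := by positivity
  linarith

theorem aux_lap_one_sub (hsub : IsSubordinatorLaw ν μ) (t : ℝ) (ht : 0 < t) (lam : ℝ)
    (hl : 0 ≤ lam) :
    ∫ s, (1 - Real.exp (-(lam * s))) ∂(μ t) = 1 - Real.exp (-(t * laplaceExp ν lam)) := by
  have := hsub.prob t ht
  rw [integral_sub (integrable_const _) (aux_lap_int hsub t ht lam hl), hsub.laplace t lam ht hl]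
  simp

theorem aux_tail_phi (hsub : IsSubordinatorLaw ν μ) (t : ℝ) (ht : 0 < t) (b : ℝ) (hb : 0 < b) :
    (μ t).real (Set.Ici b) ≤ 2 * (t * laplaceExp ν b⁻¹) := by
  have := hsub.prob t ht
  have h1 : ∫ s, (Set.Ici b).indicator (fun _ => (1:ℝ)) s ∂(μ t)
      ≤ ∫ s, 2 * (1 - Real.exp (-(b⁻¹ * s))) ∂(μ t) := by
    refine integral_mono_ae ?_
      (((integrable_const _).sub (aux_lap_int hsub t ht _ (by positivity))).const_mul 2) ?_
    · rw [integrable_indicator_iff measurableSet_Ici]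
      exact integrableOn_const (hs := measure_ne_top _ _)
    · filter_upwards [aux_mu_ae hsub t ht] with s hs
      by_cases hsb : s ∈ Set.Ici b
      · rw [Set.indicator_of_mem hsb]
        have h1 : 1 ≤ b⁻¹ * s := by
          rw [inv_mul_eq_div, le_div_iff₀ hb]; have := Set.mem_Ici.1 hsb; linarith
        have : Real.exp (-(b⁻¹ * s)) ≤ Real.exp (-1) := by apply Real.exp_le_exp.2; linarith
        have := Real.exp_neg_one_lt_half
        linarith
      · rw [Set.indicator_of_notMem hsb]
        have := aux_one_sub_exp_nonneg (b⁻¹ * s) (by positivity)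
        linarith
  rw [integral_indicator measurableSet_Ici, integral_const_mul,
    aux_lap_one_sub hsub t ht _ (by positivity)] at h1
  have h2 := aux_one_sub_exp_le (t * laplaceExp ν b⁻¹)
  simp at h1
  linarith

theorem aux_small_phi (hsub : IsSubordinatorLaw ν μ) (t : ℝ) (ht : 0 < t) (a : ℝ) (ha : 0 < a) :
    (μ t).real (Set.Iic a) ≤ Real.exp 1 * Real.exp (-(t * laplaceExp ν a⁻¹)) := by
  have := hsub.prob t ht
  rw [← hsub.laplace t _ ht (by positivity), ← integral_const_mul]
  have h1 : ∫ s, (Set.Iic a).indicator (fun _ => (1:ℝ)) s ∂(μ t)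
      ≤ ∫ s, Real.exp 1 * Real.exp (-(a⁻¹ * s)) ∂(μ t) := by
    refine integral_mono_ae ?_ ((aux_lap_int hsub t ht _ (by positivity)).const_mul _) ?_
    · rw [integrable_indicator_iff measurableSet_Iic]
      exact integrableOn_const (hs := measure_ne_top _ _)
    · refine Filter.Eventually.of_forall fun s => ?_
      by_cases hsb : s ∈ Set.Iic a
      · rw [Set.indicator_of_mem hsb]
        simp only
        rw [← Real.exp_add, Real.one_le_exp_iff]
        have : a⁻¹ * s ≤ 1 := by
          rw [inv_mul_eq_div, div_le_iff₀ ha]; have := Set.mem_Iic.1 hsb; linarith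
        linarith
      · rw [Set.indicator_of_notMem hsb]
        positivity
  rw [integral_indicator measurableSet_Iic] at h1
  simpa using h1

theorem aux_binom (k : ℕ) (hk : 1 ≤ k) (y : ℝ) :
    (1 - y) ^ k = ∑ j ∈ Finset.range (k + 1), (-((-1) ^ j * (k.choose j : ℝ))) * (1 - y ^ j) := by
  have h1 : ∀ z : ℝ, (1 - z) ^ k = ∑ j ∈ Finset.range (k + 1), (-1) ^ j * (k.choose j : ℝ) * z ^ j := by
    intro z
    rw [sub_eq_add_neg, add_comm, add_pow]
    refine Finset.sum_congr rfl fun j _ => ?_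
    rw [neg_pow, one_pow]; ring
  have h2 := h1 1
  rw [sub_self, zero_pow (by omega)] at h2
  simp only [one_pow, mul_one] at h2
  rw [h1 y]
  have : ∀ j, (-((-1) ^ j * (k.choose j : ℝ))) * (1 - y ^ j)
      = (-1) ^ j * (k.choose j : ℝ) * y ^ j - (-1) ^ j * (k.choose j : ℝ) := fun j => by ring
  simp_rw [this]
  rw [Finset.sum_sub_distrib, ← h2, sub_zero]

theorem aux_exp_pow (lam s : ℝ) (j : ℕ) :
    Real.exp (-(lam * s)) ^ j = Real.exp (-((j * lam) * s)) := by
  rw [← Real.exp_nat_mul]; ring_nf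

theorem aux_gk_nu (hν : IsLevyMeasure ν) (lam : ℝ) (hl : 0 ≤ lam) (k : ℕ) (hk : 1 ≤ k) :
    ∫ s, (1 - Real.exp (-(lam * s))) ^ k ∂ν =
      ∑ j ∈ Finset.range (k + 1), (-((-1) ^ j * (k.choose j : ℝ))) * laplaceExp ν (j * lam) := by
  simp_rw [aux_binom k hk, aux_exp_pow]
  rw [integral_finsetSum _ (fun (j : ℕ) _ =>
    (aux_phi_int hν (j * lam) (by positivity)).const_mul _)]
  simp_rw [integral_const_mul]
  rfl

theorem aux_gk_mu (hsub : IsSubordinatorLaw ν μ) (t : ℝ) (ht : 0 < t) (lam : ℝ) (hl : 0 ≤ lam)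
    (k : ℕ) (hk : 1 ≤ k) :
    ∫ s, (1 - Real.exp (-(lam * s))) ^ k ∂(μ t) =
      ∑ j ∈ Finset.range (k + 1), (-((-1) ^ j * (k.choose j : ℝ))) *
        (1 - Real.exp (-(t * laplaceExp ν (j * lam)))) := by
  have := hsub.prob t ht
  simp_rw [aux_binom k hk, aux_exp_pow]
  have hintg : ∀ j : ℕ, Integrable (fun s => 1 - Real.exp (-((j * lam) * s))) (μ t) := fun j =>
    (integrable_const (1:ℝ)).sub (aux_lap_int hsub t ht (j * lam) (by positivity))
  rw [integral_finsetSum _ (fun (j : ℕ) _ => (hintg j).const_mul _)]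
  simp_rw [integral_const_mul]
  refine Finset.sum_congr rfl fun j _ => ?_
  rw [aux_lap_one_sub hsub t ht _ (by positivity)]

theorem aux_exp_lim (a : ℝ) :
    Filter.Tendsto (fun n : ℕ => (n:ℝ) * (1 - Real.exp (-(a / n)))) Filter.atTop (nhds a) := by
  have h : HasDerivAt (fun x : ℝ => 1 - Real.exp (-(a * x))) a 0 := by
    have := (((hasDerivAt_id (0:ℝ)).const_mul a).neg.exp).const_sub 1
    simpa using this
  have h2 := h.tendsto_slope
  have h3 : Filter.Tendsto (fun n : ℕ => ((n:ℝ))⁻¹) Filter.atTop (nhdsWithin 0 {0}ᶜ) := by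
    rw [tendsto_nhdsWithin_iff]
    refine ⟨tendsto_inv_atTop_nhds_zero_nat, ?_⟩
    filter_upwards [Filter.eventually_gt_atTop 0] with n hn
    simp; omega
  refine (h2.comp h3).congr fun n => ?_
  simp [slope_def_field, div_eq_mul_inv]
  ring

theorem aux_gk_lim (hsub : IsSubordinatorLaw ν μ) (t : ℝ) (ht : 0 < t) (lam : ℝ) (hl : 0 ≤ lam)
    (k : ℕ) (hk : 1 ≤ k) :
    Filter.Tendsto (fun n : ℕ => (n:ℝ) * ∫ s, (1 - Real.exp (-(lam * s))) ^ k ∂(μ (t / n)))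
      Filter.atTop (nhds (t * ∫ s, (1 - Real.exp (-(lam * s))) ^ k ∂ν)) := by
  rw [aux_gk_nu hsub.levy lam hl k hk, Finset.mul_sum]
  have h : Filter.Tendsto (fun n : ℕ => ∑ j ∈ Finset.range (k + 1),
      (-((-1) ^ j * (k.choose j : ℝ))) * ((n:ℝ) * (1 - Real.exp (-((t * laplaceExp ν (j * lam)) / n)))))
      Filter.atTop (nhds (∑ j ∈ Finset.range (k + 1),
        t * (-((-1) ^ j * (k.choose j : ℝ)) * laplaceExp ν (j * lam)))) := by
    refine tendsto_finsetSum _ fun j _ => ?_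
    have := (aux_exp_lim (t * laplaceExp ν (j * lam))).const_mul (-((-1) ^ j * (k.choose j : ℝ)))
    convert this using 2
    ring
  refine h.congr' ?_
  filter_upwards [Filter.eventually_gt_atTop 0] with n hn
  have hn' : (0:ℝ) < n := by exact_mod_cast hn
  rw [aux_gk_mu hsub (t / n) (by positivity) lam hl k hk, Finset.mul_sum]
  refine Finset.sum_congr rfl fun j _ => ?_
  have : t / n * laplaceExp ν (j * lam) = t * laplaceExp ν (j * lam) / n := by ring
  rw [this]; ring

theorem aux_gk_mu_int (hsub : IsSubordinatorLaw ν μ) (t : ℝ) (ht : 0 < t) (lam : ℝ) (hl : 0 ≤ lam)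
    (k : ℕ) : Integrable (fun s => (1 - Real.exp (-(lam * s))) ^ k) (μ t) := by
  have := hsub.prob t ht
  refine Integrable.mono' (integrable_const (1:ℝ)) (by fun_prop) ?_
  filter_upwards [aux_mu_ae hsub t ht] with s hs
  have h0 := aux_one_sub_exp_nonneg (lam * s) (by positivity)
  rw [Real.norm_of_nonneg (by positivity)]
  exact pow_le_one₀ h0 (aux_one_sub_exp_le_one _)

/-- Small time upper tail. -/
theorem aux_N1 {cw cw' β₁ β₂ : ℝ} (hsub : IsSubordinatorLaw ν μ) (hcw : 0 < cw)
    (hcw' : 0 < cw') (hpoly : PolyCond ν ⊤ cw cw' β₁ β₂) :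
    ∃ C : ℝ, 0 < C ∧ ∀ t u : ℝ, 0 < t → 0 < u →
      ∀ᶠ n : ℕ in Filter.atTop, (n:ℝ) * (μ (t / n)).real (Set.Ioi u) ≤ C * (t * levyTail ν u) := by
  obtain ⟨k, hk⟩ := exists_nat_gt (max β₂ 1)
  have hk1 : 1 ≤ k := by
    have := (le_max_right β₂ 1).trans_lt hk
    exact_mod_cast this.le
  obtain ⟨C, hC, hup⟩ := aux_gk_upper hsub.levy hcw hcw' hpoly k ((le_max_left _ _).trans_lt hk)
  refine ⟨2 ^ k * (C + 1), by positivity, fun t u ht hu => ?_⟩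
  have hw := aux_w_pos hcw hpoly u hu
  have h1 := aux_gk_lim hsub t ht u⁻¹ (by positivity) k hk1
  have h2 : t * ∫ s, (1 - Real.exp (-(u⁻¹ * s))) ^ k ∂ν < (C + 1) * (t * levyTail ν u) := by
    have := hup u hu
    have h3 : 0 < t * levyTail ν u := by positivity
    nlinarith
  filter_upwards [h1.eventually_lt_const h2, Filter.eventually_gt_atTop 0] with n hn hn0
  have hn' : (0:ℝ) < n := by exact_mod_cast hn0
  have htn : 0 < t / n := by positivity
  have := hsub.prob _ htn
  have h4 : ∫ s, (Set.Ioi u).indicator (fun _ => (1:ℝ)) s ∂(μ (t / n))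
      ≤ ∫ s, 2 ^ k * (1 - Real.exp (-(u⁻¹ * s))) ^ k ∂(μ (t / n)) := by
    refine integral_mono_ae ?_ ((aux_gk_mu_int hsub _ htn _ (by positivity) k).const_mul _) ?_
    · rw [integrable_indicator_iff measurableSet_Ioi]
      exact integrableOn_const (hs := measure_ne_top _ _)
    · filter_upwards [aux_mu_ae hsub _ htn] with s hs
      by_cases hsb : s ∈ Set.Ioi u
      · rw [Set.indicator_of_mem hsb]
        have h1 : 1 ≤ u⁻¹ * s := by
          rw [inv_mul_eq_div, le_div_iff₀ hu]; have := Set.mem_Ioi.1 hsb; linarith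
        have : Real.exp (-(u⁻¹ * s)) ≤ Real.exp (-1) := by apply Real.exp_le_exp.2; linarith
        have := Real.exp_neg_one_lt_half
        rw [← mul_pow]
        exact one_le_pow₀ (by linarith)
      · rw [Set.indicator_of_notMem hsb]
        have := aux_one_sub_exp_nonneg (u⁻¹ * s) (by positivity)
        positivity
  rw [integral_indicator measurableSet_Ioi, integral_const_mul] at h4
  simp at h4
  calc (n:ℝ) * (μ (t / n)).real (Set.Ioi u)
      ≤ n * (2 ^ k * ∫ s, (1 - Real.exp (-(u⁻¹ * s))) ^ k ∂(μ (t / n))) := by gcongr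
    _ = 2 ^ k * (n * ∫ s, (1 - Real.exp (-(u⁻¹ * s))) ^ k ∂(μ (t / n))) := by ring
    _ ≤ 2 ^ k * ((C + 1) * (t * levyTail ν u)) := by gcongr
    _ = _ := by ring

/-- Small time lower tail. -/
theorem aux_N2 {cw cw' β₁ β₂ : ℝ} (hsub : IsSubordinatorLaw ν μ) (hcw : 0 < cw)
    (hcw' : 0 < cw') (hpoly : PolyCond ν ⊤ cw cw' β₁ β₂) :
    ∃ c : ℝ, 0 < c ∧ ∀ t u : ℝ, 0 < t → 0 < u →
      ∀ᶠ n : ℕ in Filter.atTop, c * (t * levyTail ν u) ≤ (n:ℝ) * (μ (t / n)).real (Set.Ioi u) := by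
  obtain ⟨k, hk⟩ := exists_nat_gt (max β₂ 1)
  have hk1 : 1 ≤ k := by
    have := (le_max_right β₂ 1).trans_lt hk
    exact_mod_cast this.le
  obtain ⟨C, hC, hup⟩ := aux_gk_upper hsub.levy hcw hcw' hpoly k ((le_max_left _ _).trans_lt hk)
  set η : ℝ := (1/2) ^ (k+1) with hη
  have hη0 : 0 < η := by positivity
  obtain ⟨ε, hε0, hε1, hεC⟩ : ∃ ε : ℝ, 0 < ε ∧ ε ≤ 1 ∧ ε * C ≤ η / 2 := by
    refine ⟨min 1 (η / 2 / C), lt_min one_pos (by positivity), min_le_left _ _, ?_⟩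
    calc min 1 (η / 2 / C) * C ≤ η / 2 / C * C := by gcongr; exact min_le_right _ _
      _ = η / 2 := by field_simp
  refine ⟨η / 4 * (cw' * (1/ε) ^ β₂)⁻¹, by positivity, fun t u ht hu => ?_⟩
  -- R = u/ε
  set R := u / ε with hR
  have hR0 : 0 < R := by positivity
  have hw := aux_w_pos hcw hpoly R hR0
  have hlow : (cw' * (1/ε) ^ β₂)⁻¹ * levyTail ν u ≤ levyTail ν R := by
    have h := aux_w_upper hcw hpoly u R hu (by rw [hR, le_div_iff₀ hε0]; nlinarith)
    have e : R / u = 1 / ε := by rw [hR]; field_simp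
    rw [e] at h
    rw [inv_mul_le_iff₀ (by positivity)]
    exact h
  have hlim := ((aux_gk_lim hsub t ht R⁻¹ (by positivity) (k+1) (by omega)).sub
    ((aux_gk_lim hsub t ht R⁻¹ (by positivity) k hk1).const_mul ε))
  have h2 : η / 4 * (t * levyTail ν R) < t * ∫ s, (1 - Real.exp (-(R⁻¹ * s))) ^ (k+1) ∂ν -
      ε * (t * ∫ s, (1 - Real.exp (-(R⁻¹ * s))) ^ k ∂ν) := by
    have a1 := aux_gk_lower hsub.levy (k+1) (by omega) R hR0
    have a2 := hup R hR0
    have a3 : 0 < t * levyTail ν R := by positivity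
    have a4 : η * (t * levyTail ν R) ≤ t * ∫ s, (1 - Real.exp (-(R⁻¹ * s))) ^ (k+1) ∂ν := by
      have := mul_le_mul_of_nonneg_left a1 ht.le
      rw [← hη] at this; linarith
    have a5 : ε * (t * ∫ s, (1 - Real.exp (-(R⁻¹ * s))) ^ k ∂ν) ≤ η / 2 * (t * levyTail ν R) := by
      calc ε * (t * ∫ s, (1 - Real.exp (-(R⁻¹ * s))) ^ k ∂ν)
          ≤ ε * (t * (C * levyTail ν R)) := by gcongr
        _ = (ε * C) * (t * levyTail ν R) := by ring
        _ ≤ _ := by gcongr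
    have := mul_pos hη0 a3
    linarith
  filter_upwards [hlim.eventually_const_lt h2, Filter.eventually_gt_atTop 0] with n hn hn0
  have hn' : (0:ℝ) < n := by exact_mod_cast hn0
  have htn : 0 < t / n := by positivity
  have := hsub.prob _ htn
  have h4 : ∫ s, (1 - Real.exp (-(R⁻¹ * s))) ^ (k+1) - ε * (1 - Real.exp (-(R⁻¹ * s))) ^ k ∂(μ (t / n))
      ≤ ∫ s, (Set.Ioi u).indicator (fun _ => (1:ℝ)) s ∂(μ (t / n)) := by
    refine integral_mono_ae ((aux_gk_mu_int hsub _ htn _ (by positivity) (k+1)).sub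
      ((aux_gk_mu_int hsub _ htn _ (by positivity) k).const_mul _)) ?_ ?_
    · rw [integrable_indicator_iff measurableSet_Ioi]
      exact integrableOn_const (hs := measure_ne_top _ _)
    · filter_upwards [aux_mu_ae hsub _ htn] with s hs
      have g0 := aux_one_sub_exp_nonneg (R⁻¹ * s) (by positivity)
      have g1 := aux_one_sub_exp_le_one (R⁻¹ * s)
      by_cases hsb : s ∈ Set.Ioi u
      · rw [Set.indicator_of_mem hsb]
        have a1 := pow_le_one₀ g0 g1 (n := k+1)
        have a2 : 0 ≤ ε * (1 - Real.exp (-(R⁻¹ * s))) ^ k := by positivity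
        linarith
      · rw [Set.indicator_of_notMem hsb]
        have hsu : s ≤ u := not_lt.1 hsb
        have : 1 - Real.exp (-(R⁻¹ * s)) ≤ ε := by
          refine (aux_one_sub_exp_le _).trans ?_
          rw [inv_mul_le_iff₀ hR0, hR]
          have : u / ε * ε = u := by field_simp
          linarith
        have a3 : 0 ≤ (1 - Real.exp (-(R⁻¹ * s))) ^ k := by positivity
        rw [pow_succ]
        nlinarith
  rw [integral_indicator measurableSet_Ioi, integral_sub (aux_gk_mu_int hsub _ htn _ (by positivity) (k+1))
      ((aux_gk_mu_int hsub _ htn _ (by positivity) k).const_mul _), integral_const_mul] at h4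
  simp only [integral_const, MeasurableSet.univ, measureReal_restrict_apply, Set.univ_inter,
    smul_eq_mul, mul_one] at h4
  calc η / 4 * (cw' * (1/ε) ^ β₂)⁻¹ * (t * levyTail ν u)
      = η / 4 * (t * ((cw' * (1/ε) ^ β₂)⁻¹ * levyTail ν u)) := by ring
    _ ≤ η / 4 * (t * levyTail ν R) := by gcongr
    _ ≤ _ := hn.le
    _ = n * (∫ s, (1 - Real.exp (-(R⁻¹ * s))) ^ (k+1) ∂(μ (t / n)) -
          ε * ∫ s, (1 - Real.exp (-(R⁻¹ * s))) ^ k ∂(μ (t / n))) := by ring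
    _ ≤ _ := by gcongr

end law


/-! ## Tail estimates -/

theorem aux_pow_le_exp (N : ℕ) (x : ℝ) (hx : 0 ≤ x) : x ^ N ≤ N.factorial * Real.exp x := by
  have := Real.pow_div_factorial_le_exp x hx N
  rwa [div_le_iff₀ (by positivity), mul_comm] at this

section tails
variable {ν : Measure ℝ} {μ : ℝ → Measure ℝ}

theorem aux_phi_small {K : ℝ} (hK2 : 2 ≤ K) (hν : IsLevyMeasure ν)
    (hK : ∀ a : ℝ, 0 < a → 2 * laplaceExp ν a ≤ laplaceExp ν (K * a))
    (t T : ℝ) (ht : 0 < t) (hT : 0 < T) (htT : t * laplaceExp ν T⁻¹ = 1) (j : ℕ) (s : ℝ)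
    (hs : K ^ j * T ≤ s) : t * laplaceExp ν s⁻¹ ≤ (1/2) ^ j := by
  have hs0 : 0 < s := lt_of_lt_of_le (by positivity) hs
  have h1 := aux_phi_double_iter hK2 hK j s⁻¹ (by positivity)
  have h2 : laplaceExp ν (K ^ j * s⁻¹) ≤ laplaceExp ν T⁻¹ := by
    refine aux_phi_mono hν _ _ (by positivity) ?_
    rw [← div_eq_mul_inv, div_le_iff₀ hs0, inv_mul_eq_div, le_div_iff₀ hT]
    exact hs
  have h3 : 2 ^ j * (t * laplaceExp ν s⁻¹) ≤ 1 := by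
    rw [← htT]; nlinarith
  have e : (1/2:ℝ)^j = 1/2^j := one_div_pow 2 j
  rw [e, le_div_iff₀ (by positivity)]
  linarith

theorem aux_phi_large {K : ℝ} (hK2 : 2 ≤ K)
    (hK : ∀ a : ℝ, 0 < a → 2 * laplaceExp ν a ≤ laplaceExp ν (K * a))
    (t T : ℝ) (ht : 0 < t) (hT : 0 < T) (htT : t * laplaceExp ν T⁻¹ = 1) (j : ℕ) :
    2 ^ j ≤ t * laplaceExp ν (K ^ j * T⁻¹) := by
  have h1 := aux_phi_double_iter hK2 hK j T⁻¹ (by positivity)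
  have h2 : 2 ^ j * (t * laplaceExp ν T⁻¹) ≤ t * laplaceExp ν (K ^ j * T⁻¹) := by nlinarith
  rwa [htT, mul_one] at h2

theorem aux_chernoff (hsub : IsSubordinatorLaw ν μ) (t : ℝ) (ht : 0 < t) (n : ℕ) (hn : 0 < n)
    (s b θ : ℝ) (hb : 0 < b) (hθ : 0 < θ) :
    (μ t).real (Set.Ici s) ≤ n * (μ (t / n)).real (Set.Ioi b) +
      Real.exp (-(θ * s)) * (∫ x, Real.exp (θ * (if x ≤ b then x else 0)) ∂(μ (t / n))) ^ n := by
  have hn' : (0:ℝ) < n := by exact_mod_cast hn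
  have htn : 0 < t / n := by positivity
  have := hsub.prob _ htn
  have hmeas : Measurable (fun x : Fin n → ℝ => ∑ i, x i) := by fun_prop
  set P := Measure.pi (fun _ : Fin n => μ (t / n)) with hP
  set f : ℝ → ℝ := fun x => Real.exp (θ * (if x ≤ b then x else 0)) with hf
  have hfm : Measurable f := by
    refine Real.measurable_exp.comp (Measurable.const_mul ?_ θ)
    exact Measurable.ite measurableSet_Iic measurable_id measurable_const
  have hfi : Integrable f (μ (t / n)) := by
    refine Integrable.mono' (integrable_const (Real.exp (θ * b))) hfm.aestronglyMeasurable ?_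
    refine Filter.Eventually.of_forall fun x => ?_
    rw [Real.norm_of_nonneg (Real.exp_pos _).le]
    apply Real.exp_le_exp.2
    apply mul_le_mul_of_nonneg_left _ hθ.le
    split_ifs with h
    · exact h
    · exact hb.le
  have hfp : Integrable (fun x : Fin n → ℝ => ∏ i, f (x i)) P :=
    Integrable.fintype_prod (fun _ => hfi)
  have hii : ∀ i : Fin n, Integrable (fun x : Fin n → ℝ =>
      (Set.Ioi b).indicator (fun _ => (1:ℝ)) (x i)) P := fun i => by
    have : Integrable ((Set.Ioi b).indicator (fun _ => (1:ℝ))) (μ (t / n)) := by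
      rw [integrable_indicator_iff measurableSet_Ioi]
      exact integrableOn_const (hs := measure_ne_top _ _)
    exact integrable_comp_eval this
  have h1 : (μ t).real (Set.Ici s) = ∫ x, ({x : Fin n → ℝ | s ≤ ∑ i, x i}).indicator
      (fun _ => (1:ℝ)) x ∂P := by
    have hms : MeasurableSet {x : Fin n → ℝ | s ≤ ∑ i, x i} := hmeas measurableSet_Ici
    rw [integral_indicator hms, aux_pi_sum hsub t ht n hn, map_measureReal_apply hmeas measurableSet_Ici]
    simp
    rfl
  rw [h1]
  have h2 : ∫ x, ({x : Fin n → ℝ | s ≤ ∑ i, x i}).indicator (fun _ => (1:ℝ)) x ∂P ≤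
      ∫ x, (∑ i, (Set.Ioi b).indicator (fun _ => (1:ℝ)) (x i)) +
        Real.exp (-(θ * s)) * ∏ i, f (x i) ∂P := by
    refine integral_mono ?_ ((integrable_finsetSum _ fun i _ => hii i).add (hfp.const_mul _)) ?_
    · have hms : MeasurableSet {x : Fin n → ℝ | s ≤ ∑ i, x i} := hmeas measurableSet_Ici
      rw [integrable_indicator_iff hms]
      exact integrableOn_const (hs := measure_ne_top _ _)
    · intro x
      have hpr : 0 ≤ Real.exp (-(θ * s)) * ∏ i, f (x i) :=
        mul_nonneg (Real.exp_pos _).le (Finset.prod_nonneg fun i _ => (Real.exp_pos _).le)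
      have hsum : 0 ≤ ∑ i, (Set.Ioi b).indicator (fun _ => (1:ℝ)) (x i) :=
        Finset.sum_nonneg fun i _ => Set.indicator_nonneg (fun _ _ => zero_le_one) _
      by_cases hx : x ∈ {x : Fin n → ℝ | s ≤ ∑ i, x i}
      · rw [Set.indicator_of_mem hx]
        simp only
        by_cases hbig : ∃ i, b < x i
        · obtain ⟨i, hi⟩ := hbig
          have : (Set.Ioi b).indicator (fun _ => (1:ℝ)) (x i) ≤
              ∑ i, (Set.Ioi b).indicator (fun _ => (1:ℝ)) (x i) :=
            Finset.single_le_sum (f := fun i => (Set.Ioi b).indicator (fun _ => (1:ℝ)) (x i))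
              (fun i _ => Set.indicator_nonneg (fun _ _ => zero_le_one) _) (Finset.mem_univ i)
          rw [Set.indicator_of_mem (Set.mem_Ioi.2 hi)] at this
          linarith
        · push Not at hbig
          have : ∏ i, f (x i) = Real.exp (θ * ∑ i, x i) := by
            rw [Finset.mul_sum, Real.exp_sum]
            refine Finset.prod_congr rfl fun i _ => ?_
            simp only [hf, if_pos (hbig i)]
          rw [this, ← Real.exp_add] at hpr ⊢
          have hx' : s ≤ ∑ i, x i := hx
          have : 1 ≤ Real.exp (-(θ * s) + θ * ∑ i, x i) := by
            rw [Real.one_le_exp_iff]; nlinarith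
          linarith
      · rw [Set.indicator_of_notMem hx]
        simp only
        linarith
  refine h2.trans (le_of_eq ?_)
  rw [integral_add (integrable_finsetSum _ fun i _ => hii i) (hfp.const_mul _),
    integral_finsetSum _ fun i _ => hii i, integral_const_mul, hP, integral_fintype_prod_eq_pow f,
    Fintype.card_fin]
  congr 1
  have : ∀ i : Fin n, ∫ x : Fin n → ℝ, (Set.Ioi b).indicator (fun _ => (1:ℝ)) (x i)
      ∂(Measure.pi (fun _ : Fin n => μ (t / n))) = (μ (t / n)).real (Set.Ioi b) := fun i => by
    have h := (measurePreserving_eval (fun _ : Fin n => μ (t / n)) i)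
    have h3 := integral_map (μ := Measure.pi (fun _ : Fin n => μ (t / n))) (φ := Function.eval i)
      (f := (Set.Ioi b).indicator (fun _ => (1:ℝ))) (measurable_pi_apply i).aemeasurable
      ((measurable_const.indicator measurableSet_Ioi).aestronglyMeasurable)
    rw [h.map_eq, integral_indicator measurableSet_Ioi] at h3
    simp only [integral_const, MeasurableSet.univ, measureReal_restrict_apply, Set.univ_inter,
      smul_eq_mul, mul_one] at h3
    rw [h3]
  simp_rw [this]
  simp

theorem aux_tail_upper {cw cw' β₁ β₂ : ℝ} (hsub : IsSubordinatorLaw ν μ) (hcw : 0 < cw)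
    (hcw' : 0 < cw') (hpoly : PolyCond ν ⊤ cw cw' β₁ β₂)
    {K : ℝ} (hK2 : 2 ≤ K)
    (hK : ∀ a : ℝ, 0 < a → 2 * laplaceExp ν a ≤ laplaceExp ν (K * a)) :
    ∃ C : ℝ, 0 < C ∧ ∀ t T s : ℝ, 0 < t → 0 < T → t * laplaceExp ν T⁻¹ = 1 → K ^ 4 * T ≤ s →
      (μ t).real (Set.Ici s) ≤ C * (t * levyTail ν s) := by
  obtain ⟨C, hC, hN1⟩ := aux_N1 hsub hcw hcw' hpoly
  obtain ⟨N, hN⟩ := exists_nat_ge β₂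
  set A : ℝ := C * cw' * (2 ^ N * N.factorial) with hA
  have hA0 : 0 < A := by positivity
  refine ⟨C * (cw' * 4 ^ β₂) + Real.exp A, by positivity, fun t T s ht hT htT hs => ?_⟩
  have hs0 : 0 < s := lt_of_lt_of_le (by positivity) hs
  have hw := aux_w_pos hcw hpoly s hs0
  have hφs := aux_phi_small hK2 hsub.levy hK t T ht hT htT 4 s hs
  set δ := t * levyTail ν s with hδ
  have hδ0 : 0 < δ := by positivity
  have hδ1 : δ ≤ 1/8 := by
    have := aux_w_le_phi hsub.levy s hs0
    have : δ ≤ 2 * (t * laplaceExp ν s⁻¹) := by rw [hδ]; nlinarith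
    norm_num at hφs
    linarith
  set L := -Real.log δ with hL
  have heL : Real.exp (-L) = δ := by rw [hL, neg_neg, Real.exp_log hδ0]
  have he3 : Real.exp 1 < 2.7182818286 := Real.exp_one_lt_d9
  have hL1 : 1 ≤ L := by
    rw [hL, le_neg, Real.log_le_iff_le_exp hδ0, Real.exp_neg]
    refine hδ1.trans ?_
    rw [one_div]
    exact inv_anti₀ (Real.exp_pos 1) (by linarith)
  have hL0 : 0 < L := by linarith
  obtain ⟨n, hn1, hn2, hn0⟩ := ((hN1 t (s / 4) ht (by positivity)).and
    ((hN1 t (s / L) ht (by positivity)).and (Filter.eventually_gt_atTop 0))).exists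
  have hn' : (0:ℝ) < n := by exact_mod_cast hn0
  have htn : 0 < t / n := by positivity
  have := hsub.prob _ htn
  have hch := aux_chernoff hsub t ht n hn0 s (s / 4) (2 * L / s) (by positivity) (by positivity)
  have hw4 : levyTail ν (s / 4) ≤ cw' * 4 ^ β₂ * levyTail ν s := by
    have := aux_w_upper hcw hpoly (s / 4) s (by positivity) (by linarith)
    have e : s / (s / 4) = 4 := by field_simp
    rwa [e] at this
  have hwL : levyTail ν (s / L) ≤ cw' * L ^ β₂ * levyTail ν s := by
    have := aux_w_upper hcw hpoly (s / L) s (by positivity) (div_le_self hs0.le hL1)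
    have e : s / (s / L) = L := by field_simp
    rwa [e] at this
  have hLb : L ^ β₂ ≤ 2 ^ N * N.factorial * Real.exp (L / 2) := by
    calc L ^ β₂ ≤ L ^ (N:ℝ) := Real.rpow_le_rpow_of_exponent_le hL1 hN
      _ = 2 ^ N * (L / 2) ^ N := by rw [Real.rpow_natCast, ← mul_pow]; congr 1; ring
      _ ≤ 2 ^ N * (N.factorial * Real.exp (L / 2)) := by
          gcongr; exact aux_pow_le_exp N _ (by positivity)
      _ = _ := by ring
  -- second part
  set p := (μ (t / n)).real (Set.Ioi (s / L)) with hp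
  set a : ℝ := 1 - Real.exp (-(t / n * laplaceExp ν (L / s))) with ha
  have hf1 : ∫ x, Real.exp (2 * L / s * (if x ≤ s / 4 then x else 0)) ∂(μ (t / n))
      ≤ 1 + (2 * Real.exp 2 * a + Real.exp (L / 2) * p) := by
    have hint1 : Integrable (fun x => 2 * Real.exp 2 * (1 - Real.exp (-(L / s * x)))) (μ (t / n)) :=
      ((integrable_const (1:ℝ)).sub (aux_lap_int hsub _ htn _ (by positivity))).const_mul _
    have hint2 : Integrable ((Set.Ioi (s / L)).indicator (fun _ => Real.exp (L / 2))) (μ (t / n)) := by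
      rw [integrable_indicator_iff measurableSet_Ioi]
      exact integrableOn_const (hs := measure_ne_top _ _)
    have hint12 : Integrable (fun x => 2 * Real.exp 2 * (1 - Real.exp (-(L / s * x))) +
        (Set.Ioi (s / L)).indicator (fun _ => Real.exp (L / 2)) x) (μ (t / n)) := hint1.add hint2
    have e : ∫ x, (1 + (2 * Real.exp 2 * (1 - Real.exp (-(L / s * x))) +
        (Set.Ioi (s / L)).indicator (fun _ => Real.exp (L / 2)) x)) ∂(μ (t / n)) =
        1 + (2 * Real.exp 2 * a + Real.exp (L / 2) * p) := by
      rw [integral_add (integrable_const _) hint12, integral_add hint1 hint2,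
        integral_const_mul, aux_lap_one_sub hsub _ htn _ (by positivity),
        integral_indicator measurableSet_Ioi]
      simp only [integral_const, MeasurableSet.univ, measureReal_restrict_apply, Set.univ_inter,
        smul_eq_mul, mul_one, probReal_univ]
      rw [mul_comm p]
    rw [← e]
    refine integral_mono_of_nonneg (Filter.Eventually.of_forall fun x => (Real.exp_pos _).le)
      ((integrable_const _).add hint12) ?_
    filter_upwards [aux_mu_ae hsub _ htn] with x hx
    have hy0 : 0 ≤ L / s * x := by positivity
    have g0 := aux_one_sub_exp_nonneg _ hy0
    have g1 : 0 ≤ 2 * Real.exp 2 * (1 - Real.exp (-(L / s * x))) := by positivity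
    have g2 : 0 ≤ (Set.Ioi (s / L)).indicator (fun _ => Real.exp (L / 2)) x :=
      Set.indicator_nonneg (fun _ _ => (Real.exp_pos _).le) _
    split_ifs with hxb
    · by_cases hxL : x ∈ Set.Ioi (s / L)
      · rw [Set.indicator_of_mem hxL]
        have : Real.exp (2 * L / s * x) ≤ Real.exp (L / 2) := by
          apply Real.exp_le_exp.2
          calc 2 * L / s * x ≤ 2 * L / s * (s / 4) := by gcongr
            _ = L / 2 := by field_simp; norm_num
        linarith
      · have hxL' : x ≤ s / L := not_lt.1 hxL
        have hy1 : L / s * x ≤ 1 := by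
          calc L / s * x ≤ L / s * (s / L) := by gcongr
            _ = 1 := by field_simp
        set y := L / s * x with hy
        have e1 : 2 * L / s * x = 2 * y := by rw [hy]; ring
        rw [e1]
        have e2 : Real.exp (2 * y) - 1 = Real.exp (2 * y) * ((1 - Real.exp (-y)) * (1 + Real.exp (-y))) := by
          have : Real.exp (2 * y) = Real.exp y * Real.exp y := by rw [← Real.exp_add]; ring_nf
          have h3 : Real.exp y * Real.exp (-y) = 1 := by rw [← Real.exp_add]; simp
          have h4 : Real.exp (2 * y) * (Real.exp (-y) * Real.exp (-y)) = 1 := by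
            rw [this]
            calc _ = (Real.exp y * Real.exp (-y)) * (Real.exp y * Real.exp (-y)) := by ring
              _ = 1 := by rw [h3]; ring
          linear_combination h4
        have e3 : Real.exp (2 * y) * ((1 - Real.exp (-y)) * (1 + Real.exp (-y)))
            ≤ Real.exp 2 * ((1 - Real.exp (-y)) * 2) := by
          have : Real.exp (-y) ≤ 1 := by linarith
          have := Real.exp_pos (-y)
          gcongr <;> linarith
        linarith
    · simp only [mul_zero, Real.exp_zero]
      linarith
  have ha0 : 0 ≤ a := by
    have := aux_phi_mono hsub.levy 0 (L / s) le_rfl (by positivity)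
    rw [aux_phi_zero] at this
    exact aux_one_sub_exp_nonneg _ (by positivity)
  have hp0 : 0 ≤ p := measureReal_nonneg
  have hna : n * a ≤ L * (1/16) := by
    have h1 : a ≤ t / n * laplaceExp ν (L / s) := aux_one_sub_exp_le _
    have h2 : laplaceExp ν (L / s) ≤ L * laplaceExp ν s⁻¹ := by
      rw [div_eq_mul_inv]; exact aux_phi_smul hsub.levy L s⁻¹ hL1 (by positivity)
    calc n * a ≤ n * (t / n * (L * laplaceExp ν s⁻¹)) := by gcongr; exact h1.trans (by gcongr)
      _ = L * (t * laplaceExp ν s⁻¹) := by field_simp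
      _ ≤ L * (1/16) := by gcongr; norm_num at hφs ⊢; exact hφs
  have hnp : Real.exp (L / 2) * (n * p) ≤ A := by
    calc Real.exp (L / 2) * (n * p) ≤ Real.exp (L / 2) * (C * (t * (cw' * L ^ β₂ * levyTail ν s))) := by
          have hn2' : n * p ≤ C * (t * (cw' * L ^ β₂ * levyTail ν s)) := hn2.trans (by gcongr)
          exact mul_le_mul_of_nonneg_left hn2' (Real.exp_pos _).le
      _ = C * cw' * (Real.exp (L/2) * δ) * L ^ β₂ := by rw [hδ]; ring
      _ ≤ C * cw' * (Real.exp (L/2) * δ) * (2 ^ N * N.factorial * Real.exp (L / 2)) := by gcongr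
      _ = A * (Real.exp (L/2) * Real.exp (L/2) * Real.exp (-L)) := by rw [hA, heL]; ring
      _ = A := by rw [← Real.exp_add, ← Real.exp_add]; ring_nf; simp
  have he2 : 2 * Real.exp 2 ≤ 16 := by
    have : Real.exp 2 = Real.exp 1 * Real.exp 1 := by rw [← Real.exp_add]; norm_num
    rw [this]; have := Real.exp_pos 1; nlinarith
  have hpow : (∫ x, Real.exp (2 * L / s * (if x ≤ s / 4 then x else 0)) ∂(μ (t / n))) ^ n
      ≤ Real.exp (L + A) := by
    calc _ ≤ (1 + (2 * Real.exp 2 * a + Real.exp (L / 2) * p)) ^ n := by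
          refine pow_le_pow_left₀ (integral_nonneg fun x => (Real.exp_pos _).le) hf1 n
      _ ≤ (Real.exp (2 * Real.exp 2 * a + Real.exp (L / 2) * p)) ^ n := by
          refine pow_le_pow_left₀ (by positivity) ?_ n
          rw [add_comm]; exact Real.add_one_le_exp _
      _ = Real.exp (2 * Real.exp 2 * (n * a) + Real.exp (L / 2) * (n * p)) := by
          rw [← Real.exp_nat_mul]; ring_nf
      _ ≤ Real.exp (L + A) := by
          apply Real.exp_le_exp.2
          have : 2 * Real.exp 2 * (n * a) ≤ 16 * (L * (1/16)) := by gcongr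
          linarith
  have hfin : Real.exp (-(2 * L / s * s)) * Real.exp (L + A) = Real.exp A * δ := by
    have : 2 * L / s * s = 2 * L := by field_simp
    rw [this, ← heL, ← Real.exp_add, ← Real.exp_add]; ring_nf
  calc (μ t).real (Set.Ici s) ≤ _ := hch
    _ ≤ C * (t * (cw' * 4 ^ β₂ * levyTail ν s)) + Real.exp (-(2 * L / s * s)) * Real.exp (L + A) := by
        have hn1' : n * (μ (t / n)).real (Set.Ioi (s / 4)) ≤
            C * (t * (cw' * 4 ^ β₂ * levyTail ν s)) := hn1.trans (by gcongr)
        exact add_le_add hn1' (mul_le_mul_of_nonneg_left hpow (Real.exp_pos _).le)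
    _ = (C * (cw' * 4 ^ β₂) + Real.exp A) * δ := by rw [hfin, hδ]; ring

theorem aux_tail_lower {cw cw' β₁ β₂ : ℝ} (hsub : IsSubordinatorLaw ν μ) (hcw : 0 < cw)
    (hcw' : 0 < cw') (hpoly : PolyCond ν ⊤ cw cw' β₁ β₂) :
    ∃ c : ℝ, 0 < c ∧ ∀ t u : ℝ, 0 < t → 0 < u → t * levyTail ν u ≤ 2 →
      c * (t * levyTail ν u) ≤ (μ t).real (Set.Ioi u) := by
  obtain ⟨c, hc, hN2⟩ := aux_N2 hsub hcw hcw' hpoly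
  refine ⟨c / (1 + 2 * c), by positivity, fun t u ht hu hle => ?_⟩
  have hw := aux_w_pos hcw hpoly u hu
  obtain ⟨n, hn1, hn0⟩ := ((hN2 t u ht hu).and (Filter.eventually_gt_atTop 0)).exists
  have hn' : (0:ℝ) < n := by exact_mod_cast hn0
  have htn : 0 < t / n := by positivity
  have := hsub.prob _ htn
  have := hsub.prob _ ht
  have hmeas : Measurable (fun x : Fin n → ℝ => ∑ i, x i) := by fun_prop
  set p := (μ (t / n)).real (Set.Ioi u) with hp
  have hp1 : p ≤ 1 := measureReal_le_one
  have hle1 : (μ t).real (Set.Iic u) ≤ (1 - p) ^ n := by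
    have e : (1 - p) = (μ (t / n)).real (Set.Iic u) := by
      rw [hp, ← Set.compl_Iic, probReal_compl_eq_one_sub measurableSet_Iic]; ring
    have e2 : (1 - p) ^ n = (Measure.pi (fun _ : Fin n => μ (t / n))).real
        (Set.univ.pi fun _ => Set.Iic u) := by
      rw [e, Measure.real, Measure.real, Measure.pi_pi, ENNReal.toReal_prod]
      simp
    rw [e2, aux_pi_sum hsub t ht n hn0, map_measureReal_apply hmeas measurableSet_Iic]
    have hae : ∀ᵐ x ∂(Measure.pi (fun _ : Fin n => μ (t / n))), ∀ i, 0 ≤ x i := by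
      rw [ae_all_iff]
      intro i
      exact (measurePreserving_eval (fun _ : Fin n => μ (t / n)) i).quasiMeasurePreserving.ae
        (aux_mu_ae hsub _ htn)
    refine ENNReal.toReal_mono (measure_ne_top _ _) (measure_mono_ae ?_)
    filter_upwards [hae] with x hx hmem
    have hmem' : ∑ i, x i ≤ u := hmem
    intro i _
    exact (Finset.single_le_sum (f := fun i => x i) (fun i _ => hx i) (Finset.mem_univ i)).trans hmem'
  have hexp : (1 - p) ^ n ≤ Real.exp (-(c * (t * levyTail ν u))) := by
    calc (1 - p) ^ n ≤ (Real.exp (-p)) ^ n := by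
          refine pow_le_pow_left₀ (by linarith) ?_ n
          have := Real.add_one_le_exp (-p); linarith
      _ = Real.exp (-(n * p)) := by rw [← Real.exp_nat_mul]; ring_nf
      _ ≤ _ := by apply Real.exp_le_exp.2; linarith
  have e : (μ t).real (Set.Ioi u) = 1 - (μ t).real (Set.Iic u) := by
    rw [← Set.compl_Iic, probReal_compl_eq_one_sub measurableSet_Iic]
  rw [e]
  set z := c * (t * levyTail ν u) with hz
  have hz0 : 0 ≤ z := by positivity
  have hz2 : z ≤ 2 * c := by rw [hz]; nlinarith
  -- 1 - e^{-z} ≥ z/(1+z)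
  have h5 : Real.exp (-z) ≤ 1 / (1 + z) := by
    rw [Real.exp_neg, one_div]
    exact inv_anti₀ (by positivity) (by have := Real.add_one_le_exp z; linarith)
  have h6 : z / (1 + 2 * c) ≤ 1 - 1 / (1 + z) := by
    have : 1 - 1 / (1 + z) = z / (1 + z) := by field_simp; ring
    rw [this]; gcongr
  have h7 : c / (1 + 2 * c) * (t * levyTail ν u) = z / (1 + 2 * c) := by rw [hz]; ring
  rw [h7]
  linarith

end tails


/-! ## Package of facts on the law of the subordinator at time `t` -/

/-- The facts on the law `P = μ t` which are used, with `T = 1 / φ⁻¹(1/t)`. -/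
structure LawF (w : ℝ → ℝ) (a b K₁ C₁ K₂ c₂ : ℝ) (Cn : ℕ → ℝ) (P : Measure ℝ) (t T : ℝ) : Prop where
  prob : IsProbabilityMeasure P
  pos : ∀ᵐ s ∂P, 0 < s
  mid : 1 / 2 ≤ P.real (Set.Icc (a * T) (b * T))
  neg : ∀ κ : ℕ, ∫⁻ s, ENNReal.ofReal ((max 1 (T / s)) ^ κ) ∂P ≤ ENNReal.ofReal (Cn κ)
  tail : ∀ u : ℝ, K₁ * T ≤ u → P.real (Set.Ici u) ≤ C₁ * (t * w u)
  window : ∀ u : ℝ, T ≤ u → c₂ * (t * w u) ≤ P.real (Set.Icc u (K₂ * u))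

theorem aux_summable (B : ℝ) (hB : 1 ≤ B) : Summable (fun j : ℕ => B ^ j * Real.exp (-(2:ℝ) ^ j)) := by
  obtain ⟨N, hN⟩ := pow_unbounded_of_one_lt (2 * B) (one_lt_two)
  refine Summable.of_nonneg_of_le (fun j => by positivity) (fun j => ?_)
    ((summable_geometric_of_lt_one (by norm_num : (0:ℝ) ≤ 1/2) (by norm_num)).mul_left (N.factorial : ℝ))
  have h1 : (2 * B) ^ j ≤ N.factorial * Real.exp ((2:ℝ) ^ j) := by
    calc (2 * B) ^ j ≤ (2 ^ N) ^ j := by gcongr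
      _ = ((2:ℝ) ^ j) ^ N := by rw [← pow_mul, ← pow_mul, mul_comm]
      _ ≤ _ := aux_pow_le_exp N _ (by positivity)
  have h2 : Real.exp ((2:ℝ) ^ j) * Real.exp (-(2:ℝ) ^ j) = 1 := by rw [← Real.exp_add]; simp
  have h3 : B ^ j = (1/2) ^ j * (2 * B) ^ j := by rw [← mul_pow]; congr 1; ring
  calc B ^ j * Real.exp (-(2:ℝ) ^ j) = (1/2) ^ j * ((2 * B) ^ j * Real.exp (-(2:ℝ) ^ j)) := by
        rw [h3]; ring
    _ ≤ (1/2) ^ j * ((N.factorial * Real.exp ((2:ℝ) ^ j)) * Real.exp (-(2:ℝ) ^ j)) := by gcongr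
    _ = (N.factorial : ℝ) * (1/2) ^ j := by
        rw [mul_assoc, h2]; ring

section pack
variable {ν : Measure ℝ} {μ : ℝ → Measure ℝ}

theorem aux_small_K {K : ℝ} (hK2 : 2 ≤ K) (hsub : IsSubordinatorLaw ν μ)
    (hK : ∀ a : ℝ, 0 < a → 2 * laplaceExp ν a ≤ laplaceExp ν (K * a))
    (t T : ℝ) (ht : 0 < t) (hT : 0 < T) (htT : t * laplaceExp ν T⁻¹ = 1) (j : ℕ) :
    (μ t).real (Set.Iic ((K ^ j)⁻¹ * T)) ≤ Real.exp 1 * Real.exp (-(2:ℝ) ^ j) := by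
  refine (aux_small_phi hsub t ht _ (by positivity)).trans ?_
  have := aux_phi_large hK2 hK t T ht hT htT j
  rw [mul_inv, inv_inv]
  gcongr

theorem aux_mu_pos {K : ℝ} (hK2 : 2 ≤ K) (hsub : IsSubordinatorLaw ν μ)
    (hK : ∀ a : ℝ, 0 < a → 2 * laplaceExp ν a ≤ laplaceExp ν (K * a))
    (t T : ℝ) (ht : 0 < t) (hT : 0 < T) (htT : t * laplaceExp ν T⁻¹ = 1) :
    ∀ᵐ s ∂(μ t), 0 < s := by
  have := hsub.prob _ ht
  have h0 : (μ t).real (Set.Iic 0) ≤ 0 := by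
    have hlim : Filter.Tendsto (fun j : ℕ => Real.exp 1 * Real.exp (-(2:ℝ) ^ j)) Filter.atTop (nhds (Real.exp 1 * 0)) := by
      refine Filter.Tendsto.const_mul _ ?_
      exact (Real.tendsto_exp_neg_atTop_nhds_zero).comp (tendsto_pow_atTop_atTop_of_one_lt one_lt_two)
    rw [mul_zero] at hlim
    refine ge_of_tendsto' hlim fun j => ?_
    refine le_trans (measureReal_mono (Set.Iic_subset_Iic.2 (by positivity)))
      (aux_small_K hK2 hsub hK t T ht hT htT j)
  have h1 : (μ t).real (Set.Iic 0) = 0 := le_antisymm h0 measureReal_nonneg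
  rw [measureReal_eq_zero_iff] at h1
  rw [ae_iff]
  convert h1 using 2
  ext s; simp

theorem aux_neg_moment {K : ℝ} (hK2 : 2 ≤ K) (hsub : IsSubordinatorLaw ν μ)
    (hK : ∀ a : ℝ, 0 < a → 2 * laplaceExp ν a ≤ laplaceExp ν (K * a)) (κ : ℕ) :
    ∃ C : ℝ, 0 < C ∧ ∀ (t T : ℝ), 0 < t → 0 < T → t * laplaceExp ν T⁻¹ = 1 →
    ∫⁻ s, ENNReal.ofReal ((max 1 (T / s)) ^ κ) ∂(μ t) ≤ ENNReal.ofReal C := by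
  set B := K ^ κ with hB
  have hB1 : 1 ≤ B := one_le_pow₀ (by linarith)
  have hsum := aux_summable B hB1
  have hS0 : 0 ≤ ∑' j : ℕ, B ^ j * Real.exp (-(2:ℝ) ^ j) := tsum_nonneg fun j => by positivity
  refine ⟨1 + Real.exp 1 * B * ∑' j : ℕ, B ^ j * Real.exp (-(2:ℝ) ^ j), by positivity,
    fun t T ht hT htT => ?_⟩
  have := hsub.prob _ ht
  have hpt : ∀ᵐ s ∂(μ t), ENNReal.ofReal ((max 1 (T / s)) ^ κ) ≤
      1 + ∑' j : ℕ, ENNReal.ofReal (Real.exp 1 * B * B ^ j * Real.exp (-(K ^ j * T⁻¹ * s))) := by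
    filter_upwards [aux_mu_pos hK2 hsub hK t T ht hT htT] with s hs
    rcases le_total (T / s) 1 with h | h
    · rw [max_eq_left h]; simp
    · rw [max_eq_right h]
      obtain ⟨j, hj1, hj2⟩ := exists_nat_pow_near h (by linarith : 1 < K)
      refine le_trans ?_ (le_trans (ENNReal.le_tsum j) le_add_self)
      apply ENNReal.ofReal_le_ofReal
      have h2 : K ^ j * T⁻¹ * s ≤ 1 := by
        calc K ^ j * T⁻¹ * s ≤ (T / s) * T⁻¹ * s := by gcongr
          _ = 1 := by field_simp
      have h3 : 1 ≤ Real.exp 1 * Real.exp (-(K ^ j * T⁻¹ * s)) := by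
        rw [← Real.exp_add, Real.one_le_exp_iff]; linarith
      calc (T / s) ^ κ ≤ (K ^ (j + 1)) ^ κ := by gcongr
        _ = B * B ^ j * 1 := by
          rw [hB, ← pow_mul, ← pow_mul, ← pow_add, mul_one]; congr 1; ring
        _ ≤ B * B ^ j * (Real.exp 1 * Real.exp (-(K ^ j * T⁻¹ * s))) := by gcongr
        _ = _ := by ring
  refine (lintegral_mono_ae hpt).trans ?_
  rw [lintegral_add_left measurable_const, lintegral_tsum (fun j => by fun_prop)]
  have hj : ∀ j : ℕ, ∫⁻ s, ENNReal.ofReal (Real.exp 1 * B * B ^ j * Real.exp (-(K ^ j * T⁻¹ * s))) ∂(μ t)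
      ≤ ENNReal.ofReal (Real.exp 1 * B * (B ^ j * Real.exp (-(2:ℝ) ^ j))) := fun j => by
    rw [← ofReal_integral_eq_lintegral_ofReal]
    · apply ENNReal.ofReal_le_ofReal
      rw [integral_const_mul, hsub.laplace t _ ht (by positivity), mul_assoc (Real.exp 1 * B)]
      have := aux_phi_large hK2 hK t T ht hT htT j
      gcongr
    · exact (aux_lap_int hsub _ ht _ (by positivity)).const_mul _
    · exact Filter.Eventually.of_forall fun s => by positivity
  have hs2 : ∑' j : ℕ, ∫⁻ s, ENNReal.ofReal (Real.exp 1 * B * B ^ j * Real.exp (-(K ^ j * T⁻¹ * s))) ∂(μ t)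
      ≤ ENNReal.ofReal (Real.exp 1 * B * ∑' j : ℕ, B ^ j * Real.exp (-(2:ℝ) ^ j)) := by
    refine (ENNReal.tsum_le_tsum hj).trans ?_
    rw [← tsum_mul_left, ENNReal.ofReal_tsum_of_nonneg (fun j => by positivity) (hsum.mul_left _)]
  rw [ENNReal.ofReal_add (by norm_num) (by positivity)]
  refine add_le_add ?_ hs2
  simp

theorem aux_law {cw cw' β₁ β₂ : ℝ} (hsub : IsSubordinatorLaw ν μ) (hcw : 0 < cw)
    (hcw' : 0 < cw') (hβ₁ : 0 < β₁) (hpoly : PolyCond ν ⊤ cw cw' β₁ β₂) :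
    ∃ (a b K₁ C₁ K₂ c₂ : ℝ) (Cn : ℕ → ℝ), 0 < a ∧ a ≤ 1 ∧ 1 ≤ b ∧ 1 ≤ K₁ ∧ 0 < C₁ ∧ 1 ≤ K₂ ∧ 0 < c₂ ∧
      (∀ κ, 0 < Cn κ) ∧ ∀ t T : ℝ, 0 < t → 0 < T → t * laplaceExp ν T⁻¹ = 1 →
        LawF (levyTail ν) a b K₁ C₁ K₂ c₂ Cn (μ t) t T := by
  obtain ⟨K, hK2, hK⟩ := aux_phi_double hsub.levy hcw hβ₁ hpoly
  obtain ⟨C₁, hC₁, htu⟩ := aux_tail_upper hsub hcw hcw' hpoly hK2 hK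
  obtain ⟨c, hc, htl⟩ := aux_tail_lower hsub hcw hcw' hpoly
  choose Cn hCn0 hCn using fun κ => aux_neg_moment hK2 hsub hK κ
  set K₂ : ℝ := max (K ^ 4) ((2 * C₁ / (c * cw)) ^ (1 / β₁)) with hK₂
  have hK4 : 1 ≤ K ^ 4 := one_le_pow₀ (by linarith)
  have hK3 : 1 ≤ K ^ 3 := one_le_pow₀ (by linarith)
  have hK21 : 1 ≤ K₂ := hK4.trans (le_max_left _ _)
  refine ⟨(K ^ 3)⁻¹, K ^ 3, K ^ 4, C₁, K₂, c / 2, Cn, by positivity, inv_le_one_of_one_le₀ hK3, hK3, hK4,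
    hC₁, hK21, by positivity, hCn0, fun t T ht hT htT => ?_⟩
  have hprob := hsub.prob t ht
  refine ⟨hprob, aux_mu_pos hK2 hsub hK t T ht hT htT, ?_, fun κ => hCn κ t T ht hT htT, ?_, ?_⟩
  · have h1 := aux_small_K hK2 hsub hK t T ht hT htT 3
    have h2 : (μ t).real (Set.Ici (K ^ 3 * T)) ≤ 1 / 4 := by
      refine (aux_tail_phi hsub t ht _ (by positivity)).trans ?_
      have := aux_phi_small hK2 hsub.levy hK t T ht hT htT 3 _ le_rfl
      norm_num at this ⊢
      linarith
    have h3 : Real.exp 1 * Real.exp (-(2:ℝ) ^ 3) ≤ 1 / 4 := by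
      rw [← Real.exp_add]
      have e : (1:ℝ) + -(2:ℝ) ^ 3 = -7 := by norm_num
      rw [e, Real.exp_neg, one_div]
      apply inv_anti₀ (by norm_num)
      have := Real.add_one_le_exp (7:ℝ); linarith
    have h4 : (1:ℝ) ≤ (μ t).real (Set.Iic ((K ^ 3)⁻¹ * T)) + (μ t).real (Set.Icc ((K ^ 3)⁻¹ * T) (K ^ 3 * T))
        + (μ t).real (Set.Ici (K ^ 3 * T)) := by
      have hu : (Set.univ : Set ℝ) ⊆ (Set.Iic ((K ^ 3)⁻¹ * T) ∪ Set.Icc ((K ^ 3)⁻¹ * T) (K ^ 3 * T)) ∪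
          Set.Ici (K ^ 3 * T) := by
        intro s _
        rcases le_total s ((K ^ 3)⁻¹ * T) with h | h
        · exact Or.inl (Or.inl h)
        · rcases le_total s (K ^ 3 * T) with h' | h'
          · exact Or.inl (Or.inr ⟨h, h'⟩)
          · exact Or.inr h'
      have e : (μ t).real Set.univ = 1 := probReal_univ
      rw [← e]
      refine (measureReal_mono hu).trans ((measureReal_union_le _ _).trans ?_)
      gcongr
      exact measureReal_union_le _ _
    linarith
  · exact fun u hu => htu t T u ht hT htT hu
  · intro u hu
    have hu0 : 0 < u := hT.trans_le hu
    have hw := aux_w_pos hcw hpoly u hu0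
    have hle : t * levyTail ν u ≤ 2 := by
      have h1 := aux_w_le_phi hsub.levy u hu0
      have h2 := aux_phi_mono hsub.levy u⁻¹ T⁻¹ (by positivity) (inv_anti₀ hT hu)
      have : t * levyTail ν u ≤ t * (2 * laplaceExp ν T⁻¹) := by
        apply mul_le_mul_of_nonneg_left _ ht.le; linarith
      linarith
    have h1 := htl t u ht hu0 hle
    have hKu : K ^ 4 * T ≤ K₂ * u := by
      have := le_max_left (K ^ 4) ((2 * C₁ / (c * cw)) ^ (1 / β₁))
      gcongr
    have h2 := htu t T (K₂ * u) ht hT htT hKu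
    have hwl := aux_w_lower hcw hpoly u (K₂ * u) hu0 (le_mul_of_one_le_left hu0.le hK21)
    have e : K₂ * u / u = K₂ := by field_simp
    rw [e] at hwl
    have hp : 2 * C₁ / (c * cw) ≤ K₂ ^ β₁ := by
      calc 2 * C₁ / (c * cw) = ((2 * C₁ / (c * cw)) ^ (1 / β₁)) ^ β₁ := by
            rw [← Real.rpow_mul (by positivity)]
            have : 1 / β₁ * β₁ = 1 := by field_simp
            rw [this, Real.rpow_one]
        _ ≤ _ := Real.rpow_le_rpow (by positivity) (le_max_right _ _) hβ₁.le
    have hwK := aux_w_pos hcw hpoly (K₂ * u) (by positivity)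
    have h5 : C₁ * levyTail ν (K₂ * u) ≤ c / 2 * levyTail ν u := by
      rw [div_le_iff₀ (by positivity)] at hp
      have : 2 * C₁ * levyTail ν (K₂ * u) ≤ c * (cw * K₂ ^ β₁ * levyTail ν (K₂ * u)) := by
        calc 2 * C₁ * levyTail ν (K₂ * u) ≤ K₂ ^ β₁ * (c * cw) * levyTail ν (K₂ * u) := by gcongr
          _ = _ := by ring
      have := this.trans (mul_le_mul_of_nonneg_left hwl hc.le)
      linarith
    have h6 : (μ t).real (Set.Ioi u) ≤ (μ t).real (Set.Icc u (K₂ * u)) + (μ t).real (Set.Ici (K₂ * u)) := by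
      refine (measureReal_mono ?_).trans (measureReal_union_le _ _)
      intro s hs
      rcases le_total s (K₂ * u) with h | h
      · exact Or.inl ⟨le_of_lt hs, h⟩
      · exact Or.inr h
    have h7 : C₁ * (t * levyTail ν (K₂ * u)) ≤ c / 2 * (t * levyTail ν u) := by
      have := mul_le_mul_of_nonneg_left h5 ht.le
      linarith
    linarith

end pack


/-! ## Integral estimates -/

section integ
variable {w : ℝ → ℝ} {a b K₁ C₁ K₂ c₂ : ℝ} {Cn : ℕ → ℝ} {P : Measure ℝ} {t T : ℝ}

theorem aux_int_upper (hP : LawF w a b K₁ C₁ K₂ c₂ Cn P t T) (p : ℝ → ℝ) (hpm : Measurable p)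
    (hp0 : ∀ s, 0 ≤ p s) (M : ℝ) (hM : 0 ≤ M) (κ : ℕ) (hCn : 0 < Cn κ)
    (hle : ∀ s, 0 < s → p s ≤ M * (max 1 (T / s)) ^ κ) :
    Integrable p P ∧ ∫ s, p s ∂P ≤ M * Cn κ := by
  have h1 : ∫⁻ s, ENNReal.ofReal (p s) ∂P ≤ ENNReal.ofReal (M * Cn κ) := by
    calc ∫⁻ s, ENNReal.ofReal (p s) ∂P ≤ ∫⁻ s, ENNReal.ofReal M * ENNReal.ofReal ((max 1 (T / s)) ^ κ) ∂P := by
          refine lintegral_mono_ae ?_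
          filter_upwards [hP.pos] with s hs
          rw [← ENNReal.ofReal_mul hM]
          exact ENNReal.ofReal_le_ofReal (hle s hs)
      _ = ENNReal.ofReal M * ∫⁻ s, ENNReal.ofReal ((max 1 (T / s)) ^ κ) ∂P := by
          rw [lintegral_const_mul']; simp
      _ ≤ ENNReal.ofReal M * ENNReal.ofReal (Cn κ) := by gcongr; exact hP.neg κ
      _ = _ := by rw [← ENNReal.ofReal_mul hM]
  have hi : Integrable p P := by
    refine ⟨hpm.aestronglyMeasurable, ?_⟩
    rw [hasFiniteIntegral_iff_ofReal (Filter.Eventually.of_forall hp0)]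
    exact lt_of_le_of_lt h1 ENNReal.ofReal_lt_top
  refine ⟨hi, ?_⟩
  rw [← ofReal_integral_eq_lintegral_ofReal hi (Filter.Eventually.of_forall hp0)] at h1
  exact (ENNReal.ofReal_le_ofReal_iff (by positivity)).1 h1

theorem aux_int_set [IsProbabilityMeasure P] (p : ℝ → ℝ) (hpi : Integrable p P) (hp0 : ∀ s, 0 ≤ p s)
    (M : ℝ) (A : Set ℝ) (hA : MeasurableSet A) (hle : ∀ s ∈ A, M ≤ p s) :
    M * P.real A ≤ ∫ s, p s ∂P := by
  have h1 : ∫ s in A, M ∂P ≤ ∫ s in A, p s ∂P :=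
    setIntegral_mono_on (integrableOn_const (hs := measure_ne_top _ _)) hpi.integrableOn hA hle
  have h2 : ∫ s in A, p s ∂P ≤ ∫ s, p s ∂P :=
    setIntegral_le_integral hpi (Filter.Eventually.of_forall hp0)
  simp only [integral_const, MeasurableSet.univ, measureReal_restrict_apply, Set.univ_inter,
        smul_eq_mul] at h1
  linarith

theorem aux_int_mid (hP : LawF w a b K₁ C₁ K₂ c₂ Cn P t T) (p : ℝ → ℝ) (hpi : Integrable p P)
    (hp0 : ∀ s, 0 ≤ p s) (M : ℝ) (hM : 0 ≤ M)
    (hle : ∀ s, a * T ≤ s → s ≤ b * T → M ≤ p s) : M / 2 ≤ ∫ s, p s ∂P := by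
  have := hP.prob
  have h1 := aux_int_set p hpi hp0 M (Set.Icc (a * T) (b * T)) measurableSet_Icc
    (fun s hs => hle s hs.1 hs.2)
  have := mul_le_mul_of_nonneg_left hP.mid hM
  linarith

theorem aux_int_win (hP : LawF w a b K₁ C₁ K₂ c₂ Cn P t T) (p : ℝ → ℝ) (hpi : Integrable p P)
    (hp0 : ∀ s, 0 ≤ p s) (M : ℝ) (hM : 0 ≤ M) (R : ℝ) (hR : T ≤ R)
    (hle : ∀ s, R ≤ s → s ≤ K₂ * R → M ≤ p s) : M * (c₂ * (t * w R)) ≤ ∫ s, p s ∂P := by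
  have := hP.prob
  have h1 := aux_int_set p hpi hp0 M (Set.Icc R (K₂ * R)) measurableSet_Icc
    (fun s hs => hle s hs.1 hs.2)
  have := mul_le_mul_of_nonneg_left (hP.window R hR) hM
  linarith

theorem aux_hw_int (h w : ℝ → ℝ) (hh : Antitone h) (h0 : ∀ s, 0 ≤ h s) (h1 : ∀ s, h s ≤ 1)
    (hw : Measurable w) (hw0 : ∀ u, 0 < u → 0 ≤ w u) (hwa : ∀ u v, 0 < u → u ≤ v → w v ≤ w u)
    (A B : ℝ) (hA : 0 < A) : IntegrableOn (fun s => h s * w s) (Set.Ioc A B) := by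
  refine Integrable.mono' (g := fun _ => w A) (integrableOn_const (hs := by simp))
    ((hh.measurable.mul hw).aestronglyMeasurable) ?_
  rw [ae_restrict_iff' measurableSet_Ioc]
  refine Filter.Eventually.of_forall fun s hs => ?_
  have hs0 : 0 < s := hA.trans hs.1
  rw [Real.norm_of_nonneg (mul_nonneg (h0 s) (hw0 s hs0))]
  calc h s * w s ≤ 1 * w A := mul_le_mul (h1 s) (hwa A s hA hs.1.le) (hw0 s hs0) zero_le_one
    _ = w A := one_mul _

theorem aux_int_B_lower (hP : LawF w a b K₁ C₁ K₂ c₂ Cn P t T) (ht : 0 < t) (hT : 0 < T)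
    (hc₂ : 0 < c₂) (hK₂ : 1 ≤ K₂) (p : ℝ → ℝ) (hpi : Integrable p P)
    (hp0 : ∀ s, 0 ≤ p s) (M : ℝ) (hM : 0 ≤ M) (R : ℝ) (hR : T ≤ R)
    (h : ℝ → ℝ) (hh : Antitone h) (h0 : ∀ s, 0 ≤ h s) (h1 : ∀ s, h s ≤ 1)
    (hw : Measurable w) (hw0 : ∀ u, 0 < u → 0 ≤ w u) (hwa : ∀ u v, 0 < u → u ≤ v → w v ≤ w u)
    (Dc : ℝ) (hD : 0 < Dc) (hDh : ∀ u s, 0 < u → u ≤ s → s ≤ K₂ * u → h u ≤ Dc * h s)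
    (hle : ∀ s, T ≤ s → s ≤ 4 * K₂ * R → M * (s * h s) ≤ p s) :
    M * (c₂ / Dc * (t * ∫ s in Set.Ioc (2 * T) (4 * R), h s * w s)) ≤ ∫ s, p s ∂P := by
  have hprob := hP.prob
  rcases hM.eq_or_lt with hM0 | hM0
  · rw [← hM0, zero_mul]; exact integral_nonneg hp0
  have hR0 : 0 < R := hT.trans_le hR
  have hintg := aux_hw_int h w hh h0 h1 hw hw0 hwa (2 * T) (4 * R) (by positivity)
  set I := Set.Ioc (2 * T) (4 * R) with hI
  set F : ℝ → ℝ → ℝ≥0∞ := fun u s => ({q : ℝ × ℝ | q.1 ≤ q.2 ∧ q.2 ≤ K₂ * q.1}).indicator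
    (fun q => ENNReal.ofReal (Dc * h q.2)) (u, s) with hF
  have hFset : MeasurableSet {q : ℝ × ℝ | q.1 ≤ q.2 ∧ q.2 ≤ K₂ * q.1} :=
    (measurableSet_le measurable_fst measurable_snd).inter
      (measurableSet_le measurable_snd (measurable_fst.const_mul _))
  have hFm : Measurable (Function.uncurry F) := by
    have : Measurable (fun q : ℝ × ℝ => ENNReal.ofReal (Dc * h q.2)) :=
      ENNReal.measurable_ofReal.comp ((hh.measurable.comp measurable_snd).const_mul _)
    exact this.indicator hFset
  have key : ENNReal.ofReal (c₂ * t * ∫ s in I, h s * w s) ≤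
      ENNReal.ofReal (Dc * M⁻¹ * ∫ s, p s ∂P) := by
    calc ENNReal.ofReal (c₂ * t * ∫ s in I, h s * w s)
        = ENNReal.ofReal (∫ s in I, c₂ * t * (h s * w s)) := by rw [integral_const_mul]
      _ = ∫⁻ u in I, ENNReal.ofReal (c₂ * t * (h u * w u)) := by
          refine ofReal_integral_eq_lintegral_ofReal (hintg.const_mul _) ?_
          filter_upwards [ae_restrict_mem measurableSet_Ioc] with u hu
          have hu0 : 0 < u := lt_trans (by positivity) hu.1
          have := hw0 u hu0
          have := h0 u
          simp only [Pi.zero_apply]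
          positivity
      _ ≤ ∫⁻ u in I, ∫⁻ s, F u s ∂P := by
          refine setLIntegral_mono' measurableSet_Ioc fun u hu => ?_
          have hu0 : 0 < u := lt_trans (by positivity) hu.1
          have hTu : T ≤ u := by linarith [hu.1]
          calc ENNReal.ofReal (c₂ * t * (h u * w u)) = ENNReal.ofReal (h u) * ENNReal.ofReal (c₂ * (t * w u)) := by
                rw [← ENNReal.ofReal_mul (h0 u)]; ring_nf
            _ ≤ ENNReal.ofReal (h u) * P (Set.Icc u (K₂ * u)) := by
                gcongr
                refine ENNReal.ofReal_le_of_le_toReal (hP.window u hTu)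
            _ = ∫⁻ s in Set.Icc u (K₂ * u), ENNReal.ofReal (h u) ∂P := by
                rw [setLIntegral_const]
            _ ≤ ∫⁻ s in Set.Icc u (K₂ * u), F u s ∂P := by
                refine setLIntegral_mono' measurableSet_Icc fun s hs => ?_
                simp only [hF]
                rw [Set.indicator_of_mem (show (u, s) ∈ {q : ℝ × ℝ | q.1 ≤ q.2 ∧ q.2 ≤ K₂ * q.1} from hs)]
                exact ENNReal.ofReal_le_ofReal (hDh u s hu0 hs.1 hs.2)
            _ ≤ ∫⁻ s, F u s ∂P := setLIntegral_le_lintegral _ _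
      _ = ∫⁻ s, (∫⁻ u in I, F u s) ∂P := lintegral_lintegral_swap hFm.aemeasurable
      _ ≤ ∫⁻ s, ENNReal.ofReal (Dc * M⁻¹ * p s) ∂P := by
          refine lintegral_mono fun s => ?_
          by_cases hs : 2 * T ≤ s ∧ s ≤ 4 * K₂ * R
          · have hs0 : 0 < s := lt_of_lt_of_le (by positivity) hs.1
            calc ∫⁻ u in I, F u s ≤ ∫⁻ u in I, (Set.Ioc 0 s).indicator (fun _ => ENNReal.ofReal (Dc * h s)) u := by
                  refine setLIntegral_mono' measurableSet_Ioc fun u hu => ?_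
                  have hu0 : 0 < u := lt_trans (by positivity) hu.1
                  simp only [hF]
                  by_cases hus : (u, s) ∈ {q : ℝ × ℝ | q.1 ≤ q.2 ∧ q.2 ≤ K₂ * q.1}
                  · rw [Set.indicator_of_mem hus, Set.indicator_of_mem (show u ∈ Set.Ioc 0 s from ⟨hu0, hus.1⟩)]
                  · rw [Set.indicator_of_notMem hus]; exact zero_le
              _ ≤ ∫⁻ u, (Set.Ioc 0 s).indicator (fun _ => ENNReal.ofReal (Dc * h s)) u :=
                  setLIntegral_le_lintegral _ _
              _ = ENNReal.ofReal (Dc * h s) * ENNReal.ofReal s := by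
                  rw [lintegral_indicator measurableSet_Ioc, setLIntegral_const]; simp
              _ = ENNReal.ofReal (Dc * (s * h s)) := by
                  rw [← ENNReal.ofReal_mul (mul_nonneg hD.le (h0 s))]; ring_nf
              _ ≤ _ := by
                  apply ENNReal.ofReal_le_ofReal
                  rw [mul_assoc]
                  apply mul_le_mul_of_nonneg_left _ hD.le
                  rw [inv_mul_eq_div, le_div_iff₀ hM0, mul_comm]
                  exact hle s (by linarith [hs.1]) hs.2
          · have : ∫⁻ u in I, F u s = ∫⁻ u in I, 0 := by
              refine setLIntegral_congr_fun measurableSet_Ioc fun u hu => ?_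
              simp only [hF]
              apply Set.indicator_of_notMem
              rintro ⟨h3, h4⟩
              refine hs ⟨hu.1.le.trans h3, ?_⟩
              have h5 : s ≤ K₂ * u := h4
              have := mul_le_mul_of_nonneg_left hu.2 (by linarith : 0 ≤ K₂)
              linarith
            rw [this]; simp
      _ = _ := by
          rw [← ofReal_integral_eq_lintegral_ofReal (hpi.const_mul _), integral_const_mul]
          refine Filter.Eventually.of_forall fun s => ?_
          have := hp0 s
          simp only [Pi.zero_apply]
          positivity
  have hp1 : 0 ≤ ∫ s, p s ∂P := integral_nonneg hp0
  rw [ENNReal.ofReal_le_ofReal_iff (by positivity)] at key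
  have := mul_le_mul_of_nonneg_left key (by positivity : 0 ≤ M / Dc)
  have e : M / Dc * (Dc * M⁻¹ * ∫ s, p s ∂P) = ∫ s, p s ∂P := by field_simp
  rw [e] at this
  refine le_trans (le_of_eq ?_) this
  ring

theorem aux_int_B_upper (hP : LawF w a b K₁ C₁ K₂ c₂ Cn P t T) (ht : 0 < t) (hT : 0 < T)
    (hC₁ : 0 < C₁) (K₃ : ℝ) (hK₃ : 4 ≤ K₃) (hK₃' : 2 * K₁ ≤ K₃) (R : ℝ) (hR : T ≤ R)
    (h : ℝ → ℝ) (hh : Antitone h) (h0 : ∀ s, 0 ≤ h s) (h1 : ∀ s, h s ≤ 1)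
    (hw : Measurable w) (hw0 : ∀ u, 0 < u → 0 ≤ w u) (hwa : ∀ u v, 0 < u → u ≤ v → w v ≤ w u) :
    ∫⁻ s in Set.Ioc (K₃ * T) R, ENNReal.ofReal (s * h s) ∂P ≤
      ENNReal.ofReal (2 * C₁ * (t * ∫ s in Set.Ioc (2 * T) (4 * R), h s * w s)) := by
  have hprob := hP.prob
  have hR0 : 0 < R := hT.trans_le hR
  have hintg := aux_hw_int h w hh h0 h1 hw hw0 hwa (2 * T) (4 * R) (by positivity)
  set I := Set.Ioc (2 * T) (4 * R) with hI
  set J := Set.Ioc (K₃ * T) R with hJ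
  set F : ℝ → ℝ → ℝ≥0∞ := fun s u => ({q : ℝ × ℝ | q.1 / 2 < q.2 ∧ q.2 ≤ q.1}).indicator
    (fun q => ENNReal.ofReal (2 * h q.2)) (s, u) with hF
  have hFset : MeasurableSet {q : ℝ × ℝ | q.1 / 2 < q.2 ∧ q.2 ≤ q.1} :=
    (measurableSet_lt (measurable_fst.div_const _) measurable_snd).inter
      (measurableSet_le measurable_snd measurable_fst)
  have hFm : Measurable (Function.uncurry F) := by
    have : Measurable (fun q : ℝ × ℝ => ENNReal.ofReal (2 * h q.2)) :=
      ENNReal.measurable_ofReal.comp ((hh.measurable.comp measurable_snd).const_mul _)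
    exact this.indicator hFset
  calc ∫⁻ s in J, ENNReal.ofReal (s * h s) ∂P ≤ ∫⁻ s in J, (∫⁻ u, F s u) ∂P := by
        refine setLIntegral_mono' measurableSet_Ioc fun s hs => ?_
        have hs0 : 0 < s := lt_trans (by positivity) hs.1
        calc ENNReal.ofReal (s * h s) = ENNReal.ofReal (2 * h s) * ENNReal.ofReal (s - s / 2) := by
              rw [← ENNReal.ofReal_mul (by have := h0 s; positivity)]; ring_nf
          _ = ∫⁻ u in Set.Ioc (s / 2) s, ENNReal.ofReal (2 * h s) := by
              rw [setLIntegral_const]; simp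
          _ ≤ ∫⁻ u in Set.Ioc (s / 2) s, F s u := by
              refine setLIntegral_mono' measurableSet_Ioc fun u hu => ?_
              simp only [hF]
              rw [Set.indicator_of_mem (show (s, u) ∈ {q : ℝ × ℝ | q.1 / 2 < q.2 ∧ q.2 ≤ q.1} from hu)]
              apply ENNReal.ofReal_le_ofReal
              have := hh hu.2
              linarith
          _ ≤ _ := setLIntegral_le_lintegral _ _
    _ = ∫⁻ u, ∫⁻ s in J, F s u ∂P := lintegral_lintegral_swap hFm.aemeasurable
    _ ≤ ∫⁻ u, I.indicator (fun u => ENNReal.ofReal (2 * C₁ * t * (h u * w u))) u := by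
        refine lintegral_mono fun u => ?_
        by_cases hu : u ∈ Set.Ioc (K₃ * T / 2) R
        · have hu2 : 2 * T < u := by
            have := hu.1
            nlinarith
          have hu0 : 0 < u := lt_trans (by positivity) hu2
          have huI : u ∈ I := ⟨hu2, by linarith [hu.2]⟩
          rw [Set.indicator_of_mem huI]
          have hu1 : K₁ * T ≤ u := by
            have := hu.1
            nlinarith
          calc ∫⁻ s in J, F s u ∂P ≤ ∫⁻ s, F s u ∂P := setLIntegral_le_lintegral _ _
            _ ≤ ∫⁻ s, (Set.Ici u).indicator (fun _ => ENNReal.ofReal (2 * h u)) s ∂P := by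
                refine lintegral_mono fun s => ?_
                simp only [hF]
                by_cases hus : (s, u) ∈ {q : ℝ × ℝ | q.1 / 2 < q.2 ∧ q.2 ≤ q.1}
                · rw [Set.indicator_of_mem hus, Set.indicator_of_mem (show s ∈ Set.Ici u from hus.2)]
                · rw [Set.indicator_of_notMem hus]; exact zero_le
            _ = ENNReal.ofReal (2 * h u) * P (Set.Ici u) := by
                rw [lintegral_indicator measurableSet_Ici, setLIntegral_const]
            _ ≤ ENNReal.ofReal (2 * h u) * ENNReal.ofReal (C₁ * (t * w u)) := by
                gcongr
                rw [ENNReal.le_ofReal_iff_toReal_le (measure_ne_top _ _)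
                  (by have := hw0 u hu0; positivity)]
                exact hP.tail u hu1
            _ = _ := by
                rw [← ENNReal.ofReal_mul (by have := h0 u; positivity)]; ring_nf
        · have : ∫⁻ s in J, F s u ∂P = ∫⁻ s in J, 0 ∂P := by
            refine setLIntegral_congr_fun measurableSet_Ioc fun s hs => ?_
            simp only [hF]
            apply Set.indicator_of_notMem
            rintro ⟨h3, h4⟩
            have h3' : s / 2 < u := h3
            have h4' : u ≤ s := h4
            exact hu ⟨by linarith [hs.1], h4'.trans hs.2⟩
          rw [this]; simp
    _ = ∫⁻ u in I, ENNReal.ofReal (2 * C₁ * t * (h u * w u)) := by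
        rw [lintegral_indicator measurableSet_Ioc]
    _ = ENNReal.ofReal (∫ u in I, 2 * C₁ * t * (h u * w u)) := by
        refine (ofReal_integral_eq_lintegral_ofReal (hintg.const_mul _) ?_).symm
        filter_upwards [ae_restrict_mem measurableSet_Ioc] with u hu
        have hu0 : 0 < u := lt_trans (by positivity) hu.1
        have := hw0 u hu0
        have := h0 u
        simp only [Pi.zero_apply]
        positivity
    _ = _ := by rw [integral_const_mul]; ring_nf

theorem aux_int_tail (β C' : ℝ) (hC' : 0 < C') (N : ℕ) (hN : β < N) :
    ∃ C : ℝ, 0 < C ∧ ∀ (w : ℝ → ℝ) (a b K₁ C₁ K₂ c₂ : ℝ) (Cn : ℕ → ℝ) (P : Measure ℝ) (t T K₃ R : ℝ),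
      LawF w a b K₁ C₁ K₂ c₂ Cn P t T → 0 < t → 0 < T → 0 < C₁ → K₁ ≤ K₃ → 0 < R →
      (∀ u, 0 < u → 0 ≤ w u) → (∀ u v, 0 < u → u ≤ v → w v ≤ w u) →
      (∀ u, 0 < u → u ≤ R → w u ≤ C' * (R / u) ^ β * w R) →
      ∫⁻ s in Set.Ioi (K₃ * T), ENNReal.ofReal ((min 1 (s / R)) ^ N) ∂P ≤
        ENNReal.ofReal (C * C₁ * (t * w R)) := by
  obtain ⟨C, hC, hdy⟩ := aux_dyadic β N hN
  refine ⟨C * C', by positivity, ?_⟩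
  intro w a b K₁ C₁ K₂ c₂ Cn P t T K₃ R hP ht hT hC₁ hK₃ hR hw0 hwa hwR
  have hprob := hP.prob
  have hwR0 := hw0 R hR
  have := hdy (P.restrict (Set.Ioi (K₃ * T))) R (C₁ * (t * (C' * w R))) hR (by positivity) ?_
  · have e : ∫⁻ s in Set.Ioi (K₃ * T), ENNReal.ofReal ((min 1 (s / R)) ^ N) ∂P =
        ∫⁻ s in Set.Ioi 0, ENNReal.ofReal ((min 1 (s / R)) ^ N) ∂(P.restrict (Set.Ioi (K₃ * T))) := by
      rw [Measure.restrict_eq_self_of_ae_mem (μ := P.restrict (Set.Ioi (K₃ * T))) (s := Set.Ioi 0)]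
      exact ae_restrict_of_ae hP.pos
    rw [e]
    refine this.trans (le_of_eq ?_)
    congr 1; ring
  · intro u hu huR
    rw [Measure.restrict_apply measurableSet_Ioi]
    have hsub : Set.Ioi u ∩ Set.Ioi (K₃ * T) ⊆ Set.Ici (max u (K₃ * T)) := by
      intro s hs
      exact max_le (Set.mem_Ioi.1 hs.1).le (Set.mem_Ioi.1 hs.2).le
    refine (measure_mono hsub).trans ?_
    have hb : 0 ≤ C₁ * (t * (C' * w R)) * (R / u) ^ β := by positivity
    rw [ENNReal.le_ofReal_iff_toReal_le (measure_ne_top _ _) hb]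
    have h1 := hP.tail (max u (K₃ * T)) (le_trans (by gcongr) (le_max_right _ _))
    have h2 := hwa u (max u (K₃ * T)) hu (le_max_left _ _)
    have h3 := hwR u hu huR
    calc _ ≤ C₁ * (t * w (max u (K₃ * T))) := h1
      _ ≤ C₁ * (t * (C' * (R / u) ^ β * w R)) := by gcongr; exact h2.trans h3
      _ = _ := by ring

end integ


/-! ## Pointwise estimates -/

/-- Nonnegative function, with at most polynomial decay and almost decreasing. -/
structure DecF (C : ℝ) (k : ℕ) (f : ℝ → ℝ) : Prop where
  nonneg : ∀ s, 0 < s → 0 ≤ f s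
  cmp : ∀ s S, 0 < s → 0 < S → f s ≤ C * (max 1 (S / s)) ^ k * f S

theorem DecF.le_of_le {C : ℝ} {k : ℕ} {f : ℝ → ℝ} (hf : DecF C k f) (hC : 1 ≤ C) {s S L : ℝ} (hs : 0 < s)
    (hS : 0 < S) (hL : 1 ≤ L) (hle : S ≤ L * s) : f s ≤ C * L ^ k * f S := by
  have h0 := hf.nonneg S hS
  refine (hf.cmp s S hs hS).trans ?_
  have : max 1 (S / s) ≤ L := max_le hL (by rwa [div_le_iff₀ hs])
  gcongr

/-- Two-sided kernel bounds at a fixed pair of points. -/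
structure Ker (C : ℝ) (k : ℕ) (cl cexl cu cexu : ℝ) (h W Γ p : ℝ → ℝ) (r Θ : ℝ) : Prop where
  hdec : DecF C k h
  Wdec : DecF C k W
  Γdec : DecF C k Γ
  r0 : 0 ≤ r
  Θ0 : 0 ≤ Θ
  lo : ∀ s, 0 < s → cl * h s * min (W s) (Θ * s + W s * Real.exp (-(cexl * (r * Γ s) ^ 2))) ≤ p s
  up : ∀ s, 0 < s → p s ≤ cu * h s * min (W s) (Θ * s + W s * Real.exp (-(cexu * (r * Γ s) ^ 2)))

section ker
variable {C : ℝ} {k : ℕ} {cl cexl cu cexu : ℝ} {h W Γ p : ℝ → ℝ} {r Θ : ℝ}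

theorem Ker.lo_exp (hk : Ker C k cl cexl cu cexu h W Γ p r Θ) (hcl : 0 < cl) (hcexl : 0 < cexl) (s : ℝ) (hs : 0 < s) :
    cl * (h s * (W s * Real.exp (-(cexl * (r * Γ s) ^ 2)))) ≤ p s := by
  refine le_trans ?_ (hk.lo s hs)
  have h0 := hk.hdec.nonneg s hs
  have hW := hk.Wdec.nonneg s hs
  have hΘ := hk.Θ0
  rw [← mul_assoc]
  apply mul_le_mul_of_nonneg_left _ (by positivity)
  refine le_min ?_ (le_add_of_nonneg_left (by positivity))
  refine mul_le_of_le_one_right hW ?_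
  rw [Real.exp_le_one_iff]
  have : 0 ≤ cexl * (r * Γ s) ^ 2 := by positivity
  linarith

theorem Ker.lo_theta (hk : Ker C k cl cexl cu cexu h W Γ p r Θ) (hC : 1 ≤ C) (hcl : 0 < cl)
    {R L : ℝ} (hR : 0 < R) (hL : 1 ≤ L) (hΘR : Θ * R ≤ W R) (s : ℝ) (hs : 0 < s) (hsR : s ≤ L * R) :
    cl / (C * L ^ (k + 1)) * (Θ * (s * h s)) ≤ p s := by
  refine le_trans ?_ (hk.lo s hs)
  have h0 := hk.hdec.nonneg s hs
  have hW := hk.Wdec.nonneg s hs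
  have hΘ := hk.Θ0
  have hCL : 1 ≤ C * L ^ (k + 1) := one_le_mul_of_one_le_of_one_le hC (one_le_pow₀ hL)
  have h1 : Θ * s ≤ C * L ^ (k + 1) * W s := by
    have h2 : W R ≤ C * L ^ k * W s := hk.Wdec.le_of_le hC hR hs hL hsR
    calc Θ * s ≤ Θ * (L * R) := by gcongr
      _ = L * (Θ * R) := by ring
      _ ≤ L * (C * L ^ k * W s) := mul_le_mul_of_nonneg_left (hΘR.trans h2) (by linarith)
      _ = _ := by ring
  have e : cl / (C * L ^ (k + 1)) * (Θ * (s * h s)) = cl * h s * (Θ * s / (C * L ^ (k + 1))) := by ring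
  rw [e]
  apply mul_le_mul_of_nonneg_left _ (by positivity)
  refine le_min ?_ ?_
  · rw [div_le_iff₀ (by positivity), mul_comm (W s)]; exact h1
  · refine le_trans (div_le_self (by positivity) hCL) (le_add_of_nonneg_right (by positivity))

theorem Ker.lo_near (hk : Ker C k cl cexl cu cexu h W Γ p r Θ) (hC : 1 ≤ C) (hcl : 0 < cl) (hcexl : 0 < cexl)
    {S A B : ℝ} (hS : 0 < S) (hA : 1 ≤ A) (hB : 1 ≤ B) (hr : r * Γ S ≤ 1) (s : ℝ) (hs : 0 < s)
    (hAs : S ≤ A * s) (hsB : s ≤ B * S) :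
    cl * Real.exp (-(cexl * (C * A ^ k) ^ 2)) / (C * B ^ k) ^ 2 * (h S * W S) ≤ p s := by
  refine le_trans ?_ (hk.lo_exp hcl hcexl s hs)
  have h0 := hk.hdec.nonneg s hs
  have hW := hk.Wdec.nonneg s hs
  have h0S := hk.hdec.nonneg S hS
  have hWS := hk.Wdec.nonneg S hS
  have hΓ := hk.Γdec.nonneg s hs
  have hr0 := hk.r0
  have h1 : h S ≤ C * B ^ k * h s := hk.hdec.le_of_le hC hS hs hB hsB
  have h2 : W S ≤ C * B ^ k * W s := hk.Wdec.le_of_le hC hS hs hB hsB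
  have h3 : r * Γ s ≤ C * A ^ k := by
    calc r * Γ s ≤ r * (C * A ^ k * Γ S) := by
          gcongr; exact hk.Γdec.le_of_le hC hs hS hA hAs
      _ = C * A ^ k * (r * Γ S) := by ring
      _ ≤ C * A ^ k * 1 := by gcongr
      _ = _ := mul_one _
  have h4 : Real.exp (-(cexl * (C * A ^ k) ^ 2)) ≤ Real.exp (-(cexl * (r * Γ s) ^ 2)) := by
    gcongr
  have h5 : h S * W S ≤ (C * B ^ k) ^ 2 * (h s * W s) := by
    calc h S * W S ≤ (C * B ^ k * h s) * (C * B ^ k * W s) := by gcongr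
      _ = _ := by ring
  calc cl * Real.exp (-(cexl * (C * A ^ k) ^ 2)) / (C * B ^ k) ^ 2 * (h S * W S)
      ≤ cl * Real.exp (-(cexl * (C * A ^ k) ^ 2)) / (C * B ^ k) ^ 2 * ((C * B ^ k) ^ 2 * (h s * W s)) := by gcongr
    _ = cl * Real.exp (-(cexl * (C * A ^ k) ^ 2)) * (h s * W s) := by field_simp
    _ ≤ cl * Real.exp (-(cexl * (r * Γ s) ^ 2)) * (h s * W s) := by gcongr
    _ = _ := by ring

theorem Ker.lo_gauss (hk : Ker C k cl cexl cu cexu h W Γ p r Θ) (hC : 1 ≤ C) (hcl : 0 < cl) (hcexl : 0 < cexl)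
    {S A B : ℝ} (hS : 0 < S) (hA : 1 ≤ A) (hB : 1 ≤ B) (s : ℝ) (hs : 0 < s)
    (hAs : S ≤ A * s) (hsB : s ≤ B * S) :
    cl / (C * B ^ k) ^ 2 * (h S * W S * Real.exp (-(cexl * (C * A ^ k) ^ 2 * (r * Γ S) ^ 2))) ≤ p s := by
  refine le_trans ?_ (hk.lo_exp hcl hcexl s hs)
  have h0 := hk.hdec.nonneg s hs
  have hW := hk.Wdec.nonneg s hs
  have h0S := hk.hdec.nonneg S hS
  have hWS := hk.Wdec.nonneg S hS
  have hΓ := hk.Γdec.nonneg s hs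
  have hr0 := hk.r0
  have h1 : h S ≤ C * B ^ k * h s := hk.hdec.le_of_le hC hS hs hB hsB
  have h2 : W S ≤ C * B ^ k * W s := hk.Wdec.le_of_le hC hS hs hB hsB
  have h3 : r * Γ s ≤ C * A ^ k * (r * Γ S) := by
    calc r * Γ s ≤ r * (C * A ^ k * Γ S) := by
          gcongr; exact hk.Γdec.le_of_le hC hs hS hA hAs
      _ = C * A ^ k * (r * Γ S) := by ring
  have h4 : Real.exp (-(cexl * (C * A ^ k) ^ 2 * (r * Γ S) ^ 2)) ≤ Real.exp (-(cexl * (r * Γ s) ^ 2)) := by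
    rw [mul_assoc, ← mul_pow]
    gcongr
  have h5 : h S * W S ≤ (C * B ^ k) ^ 2 * (h s * W s) := by
    calc h S * W S ≤ (C * B ^ k * h s) * (C * B ^ k * W s) := by gcongr
      _ = _ := by ring
  calc _ ≤ cl / (C * B ^ k) ^ 2 * ((C * B ^ k) ^ 2 * (h s * W s) * Real.exp (-(cexl * (r * Γ s) ^ 2))) := by gcongr
    _ = _ := by field_simp

theorem Ker.up_diag (hk : Ker C k cl cexl cu cexu h W Γ p r Θ) (hcu : 0 < cu) (hC : 1 ≤ C)
    {S : ℝ} (hS : 0 < S) (s : ℝ) (hs : 0 < s) :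
    p s ≤ cu * C ^ 2 * (h S * W S) * (max 1 (S / s)) ^ (2 * k) := by
  have h0 := hk.hdec.nonneg s hs
  have hW := hk.Wdec.nonneg s hs
  have h0S := hk.hdec.nonneg S hS
  calc p s ≤ cu * h s * W s := (hk.up s hs).trans (by gcongr; exact min_le_left _ _)
    _ ≤ cu * (C * (max 1 (S / s)) ^ k * h S) * (C * (max 1 (S / s)) ^ k * W S) := by
        gcongr
        · exact hk.hdec.cmp s S hs hS
        · exact hk.Wdec.cmp s S hs hS
    _ = _ := by ring

theorem Ker.up_off (hk : Ker C k cl cexl cu cexu h W Γ p r Θ) (hcu : 0 < cu)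
    (s : ℝ) (hs : 0 < s) :
    p s ≤ cu * h s * (Θ * s + W s * Real.exp (-(cexu * (r * Γ s) ^ 2))) := by
  have h0 := hk.hdec.nonneg s hs
  exact (hk.up s hs).trans (by gcongr; exact min_le_right _ _)

theorem Ker.up_small (hk : Ker C k cl cexl cu cexu h W Γ p r Θ) (hcu : 0 < cu) (hcexu : 0 < cexu) (hC : 1 ≤ C)
    {S K₃ : ℝ} (hS : 0 < S) (hK₃ : 1 ≤ K₃) (s : ℝ) (hs : 0 < s) (hsK : s ≤ K₃ * S) :
    p s ≤ cu * C ^ 2 * K₃ * (Θ * (S * h S) +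
      h S * W S * Real.exp (-(cexu / (C * K₃ ^ k) ^ 2 * (r * Γ S) ^ 2))) * (max 1 (S / s)) ^ (2 * k) := by
  have h0 := hk.hdec.nonneg s hs
  have hW := hk.Wdec.nonneg s hs
  have h0S := hk.hdec.nonneg S hS
  have hWS := hk.Wdec.nonneg S hS
  have hΓ := hk.Γdec.nonneg s hs
  have hΓS := hk.Γdec.nonneg S hS
  have hr0 := hk.r0
  have hΘ := hk.Θ0
  set z := max 1 (S / s) with hz
  have hz1 : 1 ≤ z := le_max_left _ _
  have h3 : r * Γ S ≤ C * K₃ ^ k * (r * Γ s) := by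
    calc r * Γ S ≤ r * (C * K₃ ^ k * Γ s) := by
          gcongr; exact hk.Γdec.le_of_le hC hS hs hK₃ hsK
      _ = _ := by ring
  have h4 : Real.exp (-(cexu * (r * Γ s) ^ 2)) ≤ Real.exp (-(cexu / (C * K₃ ^ k) ^ 2 * (r * Γ S) ^ 2)) := by
    apply Real.exp_le_exp.2
    rw [neg_le_neg_iff]
    calc cexu / (C * K₃ ^ k) ^ 2 * (r * Γ S) ^ 2 ≤ cexu / (C * K₃ ^ k) ^ 2 * (C * K₃ ^ k * (r * Γ s)) ^ 2 := by gcongr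
      _ = _ := by field_simp
  set e := Real.exp (-(cexu / (C * K₃ ^ k) ^ 2 * (r * Γ S) ^ 2)) with he
  have he0 : 0 < e := Real.exp_pos _
  have hCz : 1 ≤ C * z ^ k := one_le_mul_of_one_le_of_one_le hC (one_le_pow₀ hz1)
  have hsum : Θ * s + W s * Real.exp (-(cexu * (r * Γ s) ^ 2)) ≤ C * z ^ k * K₃ * (Θ * S + W S * e) := by
    have g1 : Θ * s ≤ C * z ^ k * K₃ * (Θ * S) := by
      calc Θ * s ≤ 1 * (Θ * (K₃ * S)) := by rw [one_mul]; gcongr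
        _ ≤ C * z ^ k * (Θ * (K₃ * S)) := by gcongr
        _ = _ := by ring
    have g2 : W s * Real.exp (-(cexu * (r * Γ s) ^ 2)) ≤ C * z ^ k * K₃ * (W S * e) := by
      calc _ ≤ (C * z ^ k * W S) * e := by gcongr; exact hk.Wdec.cmp s S hs hS
        _ = C * z ^ k * 1 * (W S * e) := by ring
        _ ≤ _ := by gcongr
    calc _ ≤ C * z ^ k * K₃ * (Θ * S) + C * z ^ k * K₃ * (W S * e) := add_le_add g1 g2
      _ = _ := by ring
  calc p s ≤ cu * h s * (Θ * s + W s * Real.exp (-(cexu * (r * Γ s) ^ 2))) := hk.up_off hcu s hs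
    _ ≤ cu * (C * z ^ k * h S) * (C * z ^ k * K₃ * (Θ * S + W S * e)) := by
        gcongr
        exact hk.hdec.cmp s S hs hS
    _ = _ := by ring

theorem aux_gauss_poly (c C : ℝ) (hc : 0 < c) (hC : 0 < C) (q M : ℕ) :
    ∃ A : ℝ, 0 < A ∧ ∀ y v : ℝ, 1 ≤ v → 1 ≤ y → v ≤ C * y ^ q → Real.exp (-(c * y ^ 2)) ≤ A * (1 / v) ^ M := by
  refine ⟨C ^ M / c ^ (q * M) * (q * M).factorial, by positivity, fun y v hv hy hvy => ?_⟩
  have h1 : v ^ M ≤ C ^ M / c ^ (q * M) * (q * M).factorial * Real.exp (c * y ^ 2) := by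
    calc v ^ M ≤ (C * y ^ q) ^ M := by gcongr
      _ = C ^ M * y ^ (q * M) := by rw [mul_pow, ← pow_mul]
      _ ≤ C ^ M * (y ^ 2) ^ (q * M) := by
          gcongr
          exact le_self_pow₀ hy (by norm_num)
      _ = C ^ M / c ^ (q * M) * (c * y ^ 2) ^ (q * M) := by rw [mul_pow c]; field_simp
      _ ≤ C ^ M / c ^ (q * M) * ((q * M).factorial * Real.exp (c * y ^ 2)) := by
          gcongr; exact aux_pow_le_exp _ _ (by positivity)
      _ = _ := by ring
  rw [Real.exp_neg, one_div, inv_pow, ← div_eq_mul_inv, le_div_iff₀ (by positivity), inv_mul_eq_div,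
    div_le_iff₀ (Real.exp_pos _)]
  exact h1

theorem Ker.up_mid (C : ℝ) (k q N : ℕ) (cu cexu : ℝ) (hC : 1 ≤ C) (hcu : 0 < cu) (hcexu : 0 < cexu) :
    ∃ A : ℝ, 0 < A ∧ ∀ (cl cexl : ℝ) (h W Γ p : ℝ → ℝ) (r Θ R : ℝ),
      Ker C k cl cexl cu cexu h W Γ p r Θ → 0 < R →
      (∀ s, 0 < s → s ≤ R → 1 ≤ r * Γ s ∧ R / s ≤ C * (r * Γ s) ^ q) →
      ∀ s, 0 < s → s ≤ R → p s ≤ cu * (Θ * (s * h s)) + A * (h R * W R) * (s / R) ^ N := by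
  obtain ⟨A, hA, hAe⟩ := aux_gauss_poly cexu C hcexu (by positivity) q (N + 2 * k)
  refine ⟨cu * C ^ 2 * A, by positivity, fun cl cexl h W Γ p r Θ R hk hR hgr s hs hsR => ?_⟩
  have h0 := hk.hdec.nonneg s hs
  have hW := hk.Wdec.nonneg s hs
  have h0R := hk.hdec.nonneg R hR
  have hWR := hk.Wdec.nonneg R hR
  obtain ⟨hy, hRs⟩ := hgr s hs hsR
  have h1R : 1 ≤ R / s := by rwa [one_le_div hs]
  have he := hAe (r * Γ s) (R / s) h1R hy hRs
  rw [one_div_div] at he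
  have g1 : h s ≤ C * (R / s) ^ k * h R := by
    have := hk.hdec.cmp s R hs hR; rwa [max_eq_right h1R] at this
  have g2 : W s ≤ C * (R / s) ^ k * W R := by
    have := hk.Wdec.cmp s R hs hR; rwa [max_eq_right h1R] at this
  have e1 : (R / s) ^ k * (s / R) ^ k = 1 := by
    rw [← mul_pow]; have : R / s * (s / R) = 1 := by field_simp
    rw [this, one_pow]
  calc p s ≤ cu * h s * (Θ * s + W s * Real.exp (-(cexu * (r * Γ s) ^ 2))) := hk.up_off hcu s hs
    _ = cu * (Θ * (s * h s)) + cu * (h s * W s * Real.exp (-(cexu * (r * Γ s) ^ 2))) := by ring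
    _ ≤ cu * (Θ * (s * h s)) + cu * ((C * (R / s) ^ k * h R) * (C * (R / s) ^ k * W R) * (A * (s / R) ^ (N + 2 * k))) := by
        gcongr
    _ = cu * (Θ * (s * h s)) + cu * C ^ 2 * A * (h R * W R) * (s / R) ^ N * ((R / s) ^ k * (s / R) ^ k) ^ 2 := by ring
    _ = _ := by rw [e1]; ring

end ker


/-! ## Abstract two-sided estimate -/

theorem aux_int_off_upper {w : ℝ → ℝ} {a b K₁ C₁ K₂ c₂ : ℝ} {Cn : ℕ → ℝ} {P : Measure ℝ} {t T : ℝ}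
    (hP : LawF w a b K₁ C₁ K₂ c₂ Cn P t T) (hT : 0 < T)
    (p : ℝ → ℝ) (hpi : Integrable p P) (hp0 : ∀ s, 0 ≤ p s) (κ N : ℕ)
    (K₃ R X Y Z B₁ B₂ : ℝ) (h : ℝ → ℝ) (hh : Antitone h) (h0 : ∀ s, 0 ≤ h s) (hR : 0 < R) (hK₃ : 0 < K₃)
    (hX : 0 ≤ X) (hY : 0 ≤ Y) (hZ : 0 ≤ Z) (hB₁ : 0 ≤ B₁) (hB₂ : 0 ≤ B₂) (hCn : 0 < Cn κ)
    (hsm : ∀ s, 0 < s → s ≤ K₃ * T → p s ≤ X * (max 1 (T / s)) ^ κ)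
    (hmd : ∀ s, 0 < s → s ≤ R → p s ≤ Y * (s * h s) + Z * (s / R) ^ N)
    (hlg : ∀ s, R ≤ s → p s ≤ Z)
    (hb1 : ∫⁻ s in Set.Ioc (K₃ * T) R, ENNReal.ofReal (s * h s) ∂P ≤ ENNReal.ofReal B₁)
    (hb2 : ∫⁻ s in Set.Ioi (K₃ * T), ENNReal.ofReal ((min 1 (s / R)) ^ N) ∂P ≤ ENNReal.ofReal B₂) :
    ∫ s, p s ∂P ≤ X * Cn κ + (Y * B₁ + Z * B₂) := by
  have hKT : 0 < K₃ * T := by positivity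
  have hm1 : Measurable (fun s => ENNReal.ofReal X * ENNReal.ofReal ((max 1 (T / s)) ^ κ)) := by
    fun_prop
  have hm2 : Measurable ((Set.Ioc (K₃ * T) R).indicator fun s => ENNReal.ofReal Y * ENNReal.ofReal (s * h s)) := by
    have := hh.measurable
    exact Measurable.indicator (by fun_prop) measurableSet_Ioc
  have key : ENNReal.ofReal (∫ s, p s ∂P) ≤ ENNReal.ofReal (X * Cn κ + (Y * B₁ + Z * B₂)) := by
    rw [ofReal_integral_eq_lintegral_ofReal hpi (Filter.Eventually.of_forall hp0)]
    calc ∫⁻ s, ENNReal.ofReal (p s) ∂P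
        ≤ ∫⁻ s, (ENNReal.ofReal X * ENNReal.ofReal ((max 1 (T / s)) ^ κ) +
          ((Set.Ioc (K₃ * T) R).indicator (fun s => ENNReal.ofReal Y * ENNReal.ofReal (s * h s)) s +
          (Set.Ioi (K₃ * T)).indicator (fun s => ENNReal.ofReal Z * ENNReal.ofReal ((min 1 (s / R)) ^ N)) s)) ∂P := by
          refine lintegral_mono_ae ?_
          filter_upwards [hP.pos] with s hs
          rcases le_or_gt s (K₃ * T) with h1 | h1
          · refine le_trans ?_ le_self_add
            rw [← ENNReal.ofReal_mul hX]
            exact ENNReal.ofReal_le_ofReal (hsm s hs h1)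
          · refine le_trans ?_ le_add_self
            rw [Set.indicator_of_mem (show s ∈ Set.Ioi (K₃ * T) from h1)]
            rcases le_or_gt s R with h2 | h2
            · rw [Set.indicator_of_mem (show s ∈ Set.Ioc (K₃ * T) R from ⟨h1, h2⟩),
                ← ENNReal.ofReal_mul hY, ← ENNReal.ofReal_mul hZ, ← ENNReal.ofReal_add
                  (by have := h0 s; positivity) (by positivity)]
              rw [min_eq_right (by rwa [div_le_one hR])]
              exact ENNReal.ofReal_le_ofReal (hmd s hs h2)
            · refine le_trans ?_ le_add_self
              rw [min_eq_left (by rw [one_le_div hR]; exact h2.le), ← ENNReal.ofReal_mul hZ, one_pow, mul_one]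
              exact ENNReal.ofReal_le_ofReal (hlg s h2.le)
      _ = ENNReal.ofReal X * ∫⁻ s, ENNReal.ofReal ((max 1 (T / s)) ^ κ) ∂P +
          (ENNReal.ofReal Y * ∫⁻ s in Set.Ioc (K₃ * T) R, ENNReal.ofReal (s * h s) ∂P +
          ENNReal.ofReal Z * ∫⁻ s in Set.Ioi (K₃ * T), ENNReal.ofReal ((min 1 (s / R)) ^ N) ∂P) := by
          rw [lintegral_add_left hm1, lintegral_add_left hm2, lintegral_indicator measurableSet_Ioc,
            lintegral_indicator measurableSet_Ioi, lintegral_const_mul' _ _ ENNReal.ofReal_ne_top,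
            lintegral_const_mul' _ _ ENNReal.ofReal_ne_top, lintegral_const_mul' _ _ ENNReal.ofReal_ne_top]
      _ ≤ ENNReal.ofReal X * ENNReal.ofReal (Cn κ) + (ENNReal.ofReal Y * ENNReal.ofReal B₁ +
          ENNReal.ofReal Z * ENNReal.ofReal B₂) := by
          gcongr
          exact hP.neg κ
      _ = _ := by
          rw [← ENNReal.ofReal_mul hX, ← ENNReal.ofReal_mul hY, ← ENNReal.ofReal_mul hZ,
            ← ENNReal.ofReal_add (by positivity) (by positivity),
            ← ENNReal.ofReal_add (by positivity) (by positivity)]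
  exact (ENNReal.ofReal_le_ofReal_iff (by positivity)).1 key

/-- Off-diagonal expression. -/
noncomputable def offE (w h W Γ : ℝ → ℝ) (r Θ t T R c : ℝ) : ℝ :=
  Θ * (t * (∫ s in Set.Ioc (2 * T) (4 * R), h s * w s) + T * h T) +
    h T * W T * Real.exp (-(c * (r * Γ T) ^ 2)) + h R * (t * w R) * W R

theorem aux_abs (C : ℝ) (k q : ℕ) (cl cexl cu cexu : ℝ) (hC : 1 ≤ C) (hcl : 0 < cl) (hcexl : 0 < cexl)
    (hcu : 0 < cu) (hcexu : 0 < cexu) (w : ℝ → ℝ) (β C' : ℝ) (hC' : 0 < C')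
    (hw : Measurable w) (hw0 : ∀ u, 0 < u → 0 ≤ w u) (hwa : ∀ u v, 0 < u → u ≤ v → w v ≤ w u)
    (hwR : ∀ u R, 0 < u → u ≤ R → w u ≤ C' * (R / u) ^ β * w R)
    (a b K₁ C₁ K₂ c₂ : ℝ) (Cn : ℕ → ℝ) (ha : 0 < a) (ha1 : a ≤ 1) (hb : 1 ≤ b) (hK₁ : 1 ≤ K₁) (hC₁ : 0 < C₁)
    (hK₂ : 1 ≤ K₂) (hc₂ : 0 < c₂) (hCn : ∀ κ, 0 < Cn κ) :
    ∃ A c c' : ℝ, 1 ≤ A ∧ 0 < c ∧ 0 < c' ∧ ∀ (P : Measure ℝ) (t T : ℝ) (h W Γ p : ℝ → ℝ) (r Θ : ℝ),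
      LawF w a b K₁ C₁ K₂ c₂ Cn P t T → 0 < t → 0 < T → Ker C k cl cexl cu cexu h W Γ p r Θ →
      Measurable p → (∀ s, 0 ≤ p s) → Antitone h → (∀ s, 0 ≤ h s) → (∀ s, h s ≤ 1) →
      (r * Γ T ≤ 1 → A⁻¹ * (h T * W T) ≤ ∫ s, p s ∂P ∧ ∫ s, p s ∂P ≤ A * (h T * W T)) ∧
      (∀ R, T ≤ R → r * Γ R = 1 → Θ * R ≤ W R →
        (∀ s, 0 < s → s ≤ R → 1 ≤ r * Γ s ∧ R / s ≤ C * (r * Γ s) ^ q) →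
        A⁻¹ * offE w h W Γ r Θ t T R c ≤ ∫ s, p s ∂P ∧
        ∫ s, p s ∂P ≤ A * offE w h W Γ r Θ t T R c') := by
  obtain ⟨N, hN⟩ := exists_nat_gt β
  obtain ⟨Ct, hCt, htail⟩ := aux_int_tail β C' hC' N hN
  obtain ⟨A', hA', hmid⟩ := Ker.up_mid C k q N cu cexu hC hcu hcexu
  set K₃ : ℝ := max 4 (2 * K₁) with hK₃
  have hK₃4 : 4 ≤ K₃ := le_max_left _ _
  have hK₃K : 2 * K₁ ≤ K₃ := le_max_right _ _
  set L : ℝ := max (4 * K₂) b with hL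
  have hLK : 4 * K₂ ≤ L := le_max_left _ _
  have hLb : b ≤ L := le_max_right _ _
  have hL1 : 1 ≤ L := hb.trans hLb
  have ha' : 1 ≤ a⁻¹ := (one_le_inv₀ ha).2 ha1
  set n0 : ℝ := cl * Real.exp (-(cexl * (C * a⁻¹ ^ k) ^ 2)) / (C * b ^ k) ^ 2 with hn0
  set n1 : ℝ := cl / (C * L ^ (k + 1)) with hn1
  set m1 : ℝ := n1 * (c₂ / (C * K₂ ^ k)) with hm1
  set n2 : ℝ := n1 * (a / (C * b ^ k)) with hn2
  set n3 : ℝ := cl / (C * b ^ k) ^ 2 with hn3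
  set n4 : ℝ := cl * Real.exp (-(cexl * (C * 1 ^ k) ^ 2)) / (C * K₂ ^ k) ^ 2 with hn4
  set m4 : ℝ := n4 * c₂ with hm4
  set M0 : ℝ := cu * C ^ 2 * Cn (2 * k) with hM0
  set M1 : ℝ := cu * C ^ 2 * K₃ * Cn (2 * k) with hM1
  set M2 : ℝ := cu * (2 * C₁) with hM2
  set M3 : ℝ := (A' + cu * C ^ 2) * (Ct * C₁) with hM3
  have hCn2 := hCn (2 * k)
  have pn0 : 0 < n0 := by positivity
  have pn1 : 0 < n1 := by positivity
  have pm1 : 0 < m1 := by positivity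
  have pn2 : 0 < n2 := by positivity
  have pn3 : 0 < n3 := by positivity
  have pn4 : 0 < n4 := by positivity
  have pm4 : 0 < m4 := by positivity
  have pM0 : 0 < M0 := by positivity
  have pM1 : 0 < M1 := by positivity
  have pM2 : 0 < M2 := by positivity
  have pM3 : 0 < M3 := by positivity
  set A : ℝ := 1 + 2 / n0 + M0 + (1 / m1 + 2 / n2 + 2 / n3 + 1 / m4) + (M1 + M2 + M3) with hA
  have q0 : 0 < 2 / n0 := by positivity
  have q1 : 0 < 1 / m1 := by positivity
  have q2 : 0 < 2 / n2 := by positivity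
  have q3 : 0 < 2 / n3 := by positivity
  have q4 : 0 < 1 / m4 := by positivity
  have hA1 : 1 ≤ A := by linarith
  have hA0 : 0 < A := by linarith
  refine ⟨A, cexl * (C * a⁻¹ ^ k) ^ 2, cexu / (C * K₃ ^ k) ^ 2, hA1, by positivity, by positivity, ?_⟩
  intro P t T h W Γ p r Θ hP ht hT hk hpm hp0 hh h0 h1
  have hprob := hP.prob
  have hWT := hk.Wdec.nonneg T hT
  have hhT := h0 T
  have hΘ := hk.Θ0
  obtain ⟨hpi, hup⟩ := aux_int_upper hP p hpm hp0 (cu * C ^ 2 * (h T * W T)) (by positivity) (2 * k) hCn2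
    (fun s hs => hk.up_diag hcu hC hT s hs)
  have hI0 : 0 ≤ ∫ s, p s ∂P := integral_nonneg hp0
  have haux : ∀ s, a * T ≤ s → 0 < s ∧ T ≤ a⁻¹ * s := fun s hs => by
    refine ⟨lt_of_lt_of_le (by positivity) hs, ?_⟩
    rw [inv_mul_eq_div, le_div_iff₀ ha]; linarith
  refine ⟨fun hr => ⟨?_, ?_⟩, ?_⟩
  · have := aux_int_mid hP p hpi hp0 (n0 * (h T * W T)) (by positivity) (fun s hs1 hs2 =>
      hk.lo_near hC hcl hcexl hT ha' hb hr s (haux s hs1).1 (haux s hs1).2 hs2)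
    rw [inv_mul_le_iff₀ hA0]
    calc h T * W T = 2 / n0 * (n0 * (h T * W T) / 2) := by field_simp
      _ ≤ A * ∫ s, p s ∂P := by
        refine mul_le_mul (by linarith) this (by positivity) hA0.le
  · calc _ ≤ _ := hup
      _ = M0 * (h T * W T) := by ring
      _ ≤ A * (h T * W T) := by
        refine mul_le_mul_of_nonneg_right (by linarith) (by positivity)
  intro R hTR hrR hΘR hgr
  have hR : 0 < R := hT.trans_le hTR
  have hWR := hk.Wdec.nonneg R hR
  have hhR := h0 R
  have hwR0 := hw0 R hR
  set B : ℝ := ∫ s in Set.Ioc (2 * T) (4 * R), h s * w s with hB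
  have hB0 : 0 ≤ B := by
    refine setIntegral_nonneg measurableSet_Ioc fun s hs => ?_
    exact mul_nonneg (h0 s) (hw0 s (lt_trans (by positivity) hs.1))
  constructor
  · have l1 : m1 * (Θ * (t * B)) ≤ ∫ s, p s ∂P := by
      have := aux_int_B_lower hP ht hT hc₂ hK₂ p hpi hp0 (n1 * Θ) (by positivity) R hTR h hh h0 h1 hw hw0 hwa
        (C * K₂ ^ k) (by positivity)
        (fun u s hu hus hsu => hk.hdec.le_of_le hC hu (hu.trans_le hus) hK₂ hsu)
        (fun s hs1 hs2 => by
          have hs0 : 0 < s := hT.trans_le hs1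
          have := hk.lo_theta hC hcl hR hL1 hΘR s hs0 (hs2.trans (by gcongr))
          rw [mul_assoc]; exact this)
      refine le_trans (le_of_eq ?_) this
      rw [hm1, hB]; ring
    have l2 : n2 * (Θ * (T * h T)) / 2 ≤ ∫ s, p s ∂P := by
      refine aux_int_mid hP p hpi hp0 _ (by positivity) (fun s hs1 hs2 => ?_)
      obtain ⟨hs0, hs3⟩ := haux s hs1
      have hsR : s ≤ L * R := hs2.trans (by gcongr)
      have g1 := hk.lo_theta hC hcl hR hL1 hΘR s hs0 hsR
      have g2 : h T ≤ C * b ^ k * h s := hk.hdec.le_of_le hC hT hs0 hb hs2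
      have hhs := h0 s
      refine le_trans ?_ g1
      calc n2 * (Θ * (T * h T)) ≤ n2 * (Θ * (T * (C * b ^ k * h s))) := by gcongr
        _ = n1 * (Θ * ((a * T) * h s)) := by rw [hn2]; field_simp
        _ ≤ _ := by gcongr
    have l3 : n3 * (h T * W T * Real.exp (-(cexl * (C * a⁻¹ ^ k) ^ 2 * (r * Γ T) ^ 2))) / 2 ≤ ∫ s, p s ∂P := by
      refine aux_int_mid hP p hpi hp0 _ (by positivity) (fun s hs1 hs2 => ?_)
      exact hk.lo_gauss hC hcl hcexl hT ha' hb s (haux s hs1).1 (haux s hs1).2 hs2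
    have l4 : m4 * (h R * (t * w R) * W R) ≤ ∫ s, p s ∂P := by
      have := aux_int_win hP p hpi hp0 (n4 * (h R * W R)) (by positivity) R hTR (fun s hs1 hs2 =>
        hk.lo_near hC hcl hcexl hR le_rfl hK₂ hrR.le s (hR.trans_le hs1) (by rwa [one_mul]) hs2)
      refine le_trans (le_of_eq ?_) this
      rw [hm4]; ring
    set X3 := h T * W T * Real.exp (-(cexl * (C * a⁻¹ ^ k) ^ 2 * (r * Γ T) ^ 2)) with hX3
    rw [inv_mul_le_iff₀ hA0, offE, ← hB, ← hX3]
    set I := ∫ s, p s ∂P with hI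
    have r1 : Θ * (t * B) ≤ 1 / m1 * I := by
      rw [one_div, inv_mul_eq_div, le_div_iff₀ pm1]; linarith
    have r2 : Θ * (T * h T) ≤ 2 / n2 * I := by
      rw [div_mul_eq_mul_div, le_div_iff₀ pn2]; linarith
    have r3 : X3 ≤ 2 / n3 * I := by
      rw [div_mul_eq_mul_div, le_div_iff₀ pn3]; linarith
    have r4 : h R * (t * w R) * W R ≤ 1 / m4 * I := by
      rw [one_div, inv_mul_eq_div, le_div_iff₀ pm4]; linarith
    have : (1 / m1 + 2 / n2 + 2 / n3 + 1 / m4) * I ≤ A * I :=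
      mul_le_mul_of_nonneg_right (by linarith) hI0
    linarith
  · set X3 := h T * W T * Real.exp (-(cexu / (C * K₃ ^ k) ^ 2 * (r * Γ T) ^ 2)) with hX3
    have hX30 : 0 ≤ X3 := by positivity
    have hu := aux_int_off_upper hP hT p hpi hp0 (2 * k) N K₃ R
      (cu * C ^ 2 * K₃ * (Θ * (T * h T) + X3)) (cu * Θ) ((A' + cu * C ^ 2) * (h R * W R))
      (2 * C₁ * (t * B)) (Ct * C₁ * (t * w R)) h hh h0 hR (by positivity) (by positivity) (by positivity)
      (by positivity) (by positivity) (by positivity) hCn2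
      (fun s hs1 hs2 => hk.up_small hcu hcexu hC hT (by linarith) s hs1 hs2)
      (fun s hs1 hs2 => by
        refine (hmid cl cexl h W Γ p r Θ R hk hR hgr s hs1 hs2).trans ?_
        rw [mul_assoc cu Θ]
        gcongr
        have : 0 < cu * C ^ 2 := by positivity
        linarith)
      (fun s hs => by
        have hs0 : 0 < s := hR.trans_le hs
        have := hk.up_diag hcu hC hR s hs0
        rw [max_eq_left (by rwa [div_le_one hs0]), one_pow, mul_one] at this
        refine this.trans ?_
        gcongr
        linarith)
      (aux_int_B_upper hP ht hT hC₁ K₃ hK₃4 hK₃K R hTR h hh h0 h1 hw hw0 hwa)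
      (htail w a b K₁ C₁ K₂ c₂ Cn P t T K₃ R hP ht hT hC₁ (by linarith) hR hw0 hwa (fun u hu huR => hwR u R hu huR))
    refine hu.trans ?_
    rw [offE, ← hB, ← hX3]
    have r1 : cu * Θ * (2 * C₁ * (t * B)) ≤ A * (Θ * (t * B)) := by
      calc _ = M2 * (Θ * (t * B)) := by rw [hM2]; ring
        _ ≤ _ := mul_le_mul_of_nonneg_right (by linarith) (by positivity)
    have r2 : cu * C ^ 2 * K₃ * (Θ * (T * h T) + X3) * Cn (2 * k) ≤ A * (Θ * (T * h T) + X3) := by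
      calc _ = M1 * (Θ * (T * h T) + X3) := by rw [hM1]; ring
        _ ≤ _ := mul_le_mul_of_nonneg_right (by linarith) (by positivity)
    have r3 : (A' + cu * C ^ 2) * (h R * W R) * (Ct * C₁ * (t * w R)) ≤ A * (h R * (t * w R) * W R) := by
      calc _ = M3 * (h R * (t * w R) * W R) := by rw [hM3]; ring
        _ ≤ _ := mul_le_mul_of_nonneg_right (by linarith) (by positivity)
    calc _ ≤ A * (Θ * (T * h T) + X3) + (A * (Θ * (t * B)) + A * (h R * (t * w R) * W R)) :=
          add_le_add r2 (add_le_add r1 r3)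
      _ = _ := by ring


/-! ## Verification of the abstract hypotheses -/

theorem aux_phi_strict {ν : Measure ℝ} {cw cw' β₁ β₂ : ℝ} (hν : IsLevyMeasure ν) (hcw : 0 < cw)
    (hpoly : PolyCond ν ⊤ cw cw' β₁ β₂) (a b : ℝ) (ha : 0 < a) (hab : a < b) :
    laplaceExp ν a < laplaceExp ν b := by
  have hm := aux_phi_mono hν a b ha.le hab.le
  refine lt_of_le_of_ne hm fun heq => ?_
  have hia := aux_phi_int hν a ha.le
  have hib := aux_phi_int hν b (ha.trans hab).le
  have h1 : ∫ s, ((1 - Real.exp (-(b * s))) - (1 - Real.exp (-(a * s)))) ∂ν = 0 := by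
    rw [integral_sub hib hia]
    unfold laplaceExp at heq
    linarith
  have hsub' : Integrable (fun s => (1 - Real.exp (-(b * s))) - (1 - Real.exp (-(a * s)))) ν :=
    hib.sub hia
  rw [integral_eq_zero_iff_of_nonneg_ae _ hsub'] at h1
  · have hF : ∀ᵐ s ∂ν, False := by
      filter_upwards [h1, aux_nu_ae hν] with s hs hs0
      simp only [Pi.zero_apply] at hs
      have : Real.exp (-(a * s)) = Real.exp (-(b * s)) := by linarith
      have := Real.exp_injective this
      nlinarith
    have h2 : ν Set.univ = 0 := by
      have := (ae_iff.1 hF)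
      simpa using this
    have h3 := aux_w_pos hcw hpoly 1 one_pos
    have h4 : ν (Set.Ioi 1) = 0 := measure_mono_null (Set.subset_univ _) h2
    rw [levyTail, h4] at h3
    simp at h3
  · filter_upwards [aux_nu_ae hν] with s hs0
    simp only [Pi.zero_apply]
    have : Real.exp (-(b * s)) ≤ Real.exp (-(a * s)) := by
      apply Real.exp_le_exp.2; nlinarith
    linarith

theorem aux_DecF (f : ℝ → ℝ) (C C0 e : ℝ) (k : ℕ) (hC : 1 ≤ C) (hC0 : C0 ≤ C) (hC00 : 0 ≤ C0) (hek : e ≤ k)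
    (h0 : ∀ s, 0 < s → 0 ≤ f s) (hanti : ∀ s S, 0 < s → s ≤ S → f S ≤ f s)
    (hsc : ∀ s S, 0 < s → s ≤ S → f s ≤ C0 * (S / s) ^ e * f S) : DecF C k f := by
  refine ⟨h0, fun s S hs hS => ?_⟩
  have hfS := h0 S hS
  rcases le_total s S with h | h
  · have h1 : 1 ≤ S / s := by rwa [one_le_div hs]
    rw [max_eq_right h1]
    refine (hsc s S hs h).trans ?_
    have : (S / s) ^ e ≤ (S / s) ^ k := by
      rw [← Real.rpow_natCast]
      exact Real.rpow_le_rpow_of_exponent_le h1 hek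
    gcongr
  · rw [max_eq_left (by rwa [div_le_one hs]), one_pow, mul_one]
    have := hanti S s hS h
    nlinarith

section geom
variable {Φ ΦInv : ℝ → ℝ} {cA cA' α₁ α₂ : ℝ}

theorem aux_Phi_pos (hΦ0 : Φ 0 = 0) (hΦmono : StrictMonoOn Φ (Set.Ici 0)) (r : ℝ) (hr : 0 < r) : 0 < Φ r := by
  have := hΦmono (Set.mem_Ici.2 le_rfl) (Set.mem_Ici.2 hr.le) hr
  rwa [hΦ0] at this

theorem aux_G_mono (hΦmono : StrictMonoOn Φ (Set.Ici 0))
    (hΦInv : ∀ s : ℝ, 0 < s → 0 < ΦInv s ∧ Φ (ΦInv s) = s) (s S : ℝ) (hs : 0 < s) (hsS : s ≤ S) :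
    ΦInv s ≤ ΦInv S := by
  have h1 := hΦInv s hs
  have h2 := hΦInv S (hs.trans_le hsS)
  refine (hΦmono.le_iff_le (Set.mem_Ici.2 h1.1.le) (Set.mem_Ici.2 h2.1.le)).1 ?_
  rw [h1.2, h2.2]; exact hsS

theorem aux_G_Phi (hΦ0 : Φ 0 = 0) (hΦmono : StrictMonoOn Φ (Set.Ici 0))
    (hΦInv : ∀ s : ℝ, 0 < s → 0 < ΦInv s ∧ Φ (ΦInv s) = s) (r : ℝ) (hr : 0 < r) : ΦInv (Φ r) = r := by
  have h1 := hΦInv (Φ r) (aux_Phi_pos hΦ0 hΦmono r hr)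
  exact hΦmono.injOn (Set.mem_Ici.2 h1.1.le) (Set.mem_Ici.2 hr.le) h1.2

theorem aux_G_scale (hΦmono : StrictMonoOn Φ (Set.Ici 0)) (hcA : 0 < cA) (hα₁ : 0 < α₁)
    (hΦsc : WeakScaling Φ cA cA' α₁ α₂)
    (hΦInv : ∀ s : ℝ, 0 < s → 0 < ΦInv s ∧ Φ (ΦInv s) = s) (s S : ℝ) (hs : 0 < s) (hsS : s ≤ S) :
    ΦInv S / ΦInv s ≤ cA⁻¹ ^ (1 / α₁) * (S / s) ^ (1 / α₁) := by
  have hS := hs.trans_le hsS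
  have h1 := hΦInv s hs
  have h2 := hΦInv S hS
  have h3 := (hΦsc _ _ h1.1 (aux_G_mono hΦmono hΦInv s S hs hsS)).1
  rw [h1.2, h2.2] at h3
  have hq : 0 < ΦInv S / ΦInv s := div_pos h2.1 h1.1
  have h4 : (ΦInv S / ΦInv s) ^ α₁ ≤ cA⁻¹ * (S / s) := by
    rw [inv_mul_eq_div, le_div_iff₀ hcA]; linarith
  calc ΦInv S / ΦInv s = ((ΦInv S / ΦInv s) ^ α₁) ^ (1 / α₁) := by
        rw [← Real.rpow_mul hq.le]
        have : α₁ * (1 / α₁) = 1 := by field_simp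
        rw [this, Real.rpow_one]
    _ ≤ (cA⁻¹ * (S / s)) ^ (1 / α₁) := Real.rpow_le_rpow (by positivity) h4 (by positivity)
    _ = _ := Real.mul_rpow (by positivity) (by positivity)

end geom

theorem aux_vol_pos {E : Type*} [MetricSpace E] [MeasurableSpace E] (m : Measure E)
    (hm : ∀ (x : E) (r : ℝ), 0 < r → 0 < m (Metric.ball x r) ∧ m (Metric.ball x r) < ⊤) (x : E) (r : ℝ)
    (hr : 0 < r) : 0 < vol m x r :=
  ENNReal.toReal_pos (hm x r hr).1.ne' (hm x r hr).2.ne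

theorem aux_vol_mono {E : Type*} [MetricSpace E] [MeasurableSpace E] (m : Measure E)
    (hm : ∀ (x : E) (r : ℝ), 0 < r → 0 < m (Metric.ball x r) ∧ m (Metric.ball x r) < ⊤) (x : E) (r R : ℝ)
    (hr : 0 < r) (hrR : r ≤ R) : vol m x r ≤ vol m x R :=
  ENNReal.toReal_mono (hm x R (hr.trans_le hrR)).2.ne (measure_mono (Metric.ball_subset_ball hrR))

set_option maxHeartbeats 2000000 in
/-- Theorem 4.3: sharp two-sided estimates, valid for all times, for the heat kernel
of the subordinate process, under (Poly-∞) and HK^h_U. -/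
theorem heat_kernel_estimates_unbounded
    {E : Type*} [MetricSpace E] [MeasurableSpace E] [BorelSpace E] [ProperSpace E]
    [TopologicalSpace.SeparableSpace E]
    (m : Measure E) (R_E : ℝ≥0∞) (d₁ d₂ : ℝ)
    (hm : ∀ (x : E) (r : ℝ), 0 < r → 0 < m (Metric.ball x r) ∧ m (Metric.ball x r) < ⊤)
    (hRE : 0 < R_E) (hd₁ : 0 < d₁) (hd : d₁ ≤ d₂) (hVD : VolDoubling m R_E d₁ d₂)
    (D : Set E) (hDopen : IsOpen D) (hDne : D.Nonempty) (hDproper : D ≠ Set.univ)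
    (Φ Ψ : ℝ → ℝ) (cA cA' α₁ α₂ cB cB' α₃ α₄ : ℝ)
    (hΦ0 : Φ 0 = 0) (hΦmono : StrictMonoOn Φ (Set.Ici 0))
    (hΨ0 : Ψ 0 = 0) (hΨmono : StrictMonoOn Ψ (Set.Ici 0))
    (hΦΨ : ∀ r : ℝ, 0 ≤ r → Φ r ≤ Ψ r)
    (hcA : 0 < cA) (hcA' : 0 < cA') (hα₁ : 0 < α₁) (hα₁₂ : α₁ ≤ α₂)
    (hcB : 0 < cB) (hcB' : 0 < cB') (hα₃ : 0 < α₃) (hα₃₄ : α₃ ≤ α₄)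
    (hΦsc : WeakScaling Φ cA cA' α₁ α₂) (hΨsc : WeakScaling Ψ cB cB' α₃ α₄)
    (ΦInv : ℝ → ℝ) (hΦInv : ∀ s : ℝ, 0 < s → 0 < ΦInv s ∧ Φ (ΦInv s) = s)
    (h : ℝ → E → E → ℝ) (cH γ : ℝ) (hcH : 0 < cH) (hγ : 0 ≤ γ)
    (pD : ℝ → E → E → ℝ)
    (hpD_meas : ∀ x y : E, Measurable fun s => pD s x y)
    (hpD_nonneg : ∀ (s : ℝ) (x y : E), 0 ≤ pD s x y)
    (ν : Measure ℝ) (μ : ℝ → Measure ℝ) (hsub : IsSubordinatorLaw ν μ)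
    (φInv : ℝ → ℝ) (hφInv : IsPhiInv ν φInv)
    (R₁ : ℝ≥0∞) (cw cw' β₁ β₂ : ℝ) (hR₁ : 0 < R₁)
    (hcw : 0 < cw) (hcw' : 0 < cw') (hβ₁ : 0 < β₁) (hβ : β₁ ≤ β₂)
    (C₀ cl cexl cu cexu : ℝ) (hC₀ : C₀ = 0 ∨ C₀ = 1)
    (hcl : 0 < cl) (hcexl : 0 < cexl) (hcu : 0 < cu) (hcexu : 0 < cexu)
    (hpoly : PolyCond ν ⊤ cw cw' β₁ β₂)
    (hRE_top : R_E = ⊤)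
    (hbf : IsBoundaryFunction D h ⊤ cH γ)
    (hHK : HKest m D Ψ ΦInv h pD C₀ cl cexl cu cexu (fun _ => True)) :
    ∃ C c c' : ℝ, 1 ≤ C ∧ 0 < c ∧ 0 < c' ∧
      ∀ (t : ℝ) (x y : E), 0 < t → x ∈ D → y ∈ D →
        (psiFun ν Φ (dist x y) ≤ t →
          C⁻¹ * onDiag m h ΦInv φInv t x y ≤ subq μ pD t x y ∧
            subq μ pD t x y ≤ C * onDiag m h ΦInv φInv t x y) ∧
        (t ≤ psiFun ν Φ (dist x y) →
          C⁻¹ * offDiag ν m h Φ Ψ ΦInv φInv C₀ c t x y ≤ subq μ pD t x y ∧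
            subq μ pD t x y ≤ C * offDiag ν m h Φ Ψ ΦInv φInv C₀ c' t x y) := by
  subst hRE_top
  obtain ⟨a, b, K₁, C₁, K₂, c₂, Cn, ha, ha1, hb, hK₁, hC₁, hK₂, hc₂, hCn, hlaw⟩ :=
    aux_law hsub hcw hcw' hβ₁ hpoly
  obtain ⟨CV, hCV, hvd⟩ := hVD 1 le_rfl
  have hd₂ : 0 < d₂ := hd₁.trans_le hd
  have hα₂ : 0 < α₂ := hα₁.trans_le hα₁₂
  obtain ⟨k1, hk1⟩ := exists_nat_ge γ
  obtain ⟨k2, hk2⟩ := exists_nat_ge (1 / α₁ * d₂)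
  obtain ⟨k3, hk3⟩ := exists_nat_ge (1 / α₁)
  obtain ⟨q, hq⟩ := exists_nat_ge α₂
  set k : ℕ := k1 + k2 + k3 with hk
  have hkγ : γ ≤ (k:ℝ) := by rw [hk]; push_cast; have := Nat.cast_nonneg (α := ℝ) k2; have := Nat.cast_nonneg (α := ℝ) k3; linarith
  have hkd : 1 / α₁ * d₂ ≤ (k:ℝ) := by rw [hk]; push_cast; have := Nat.cast_nonneg (α := ℝ) k1; have := Nat.cast_nonneg (α := ℝ) k3; linarith
  have hkα : 1 / α₁ ≤ (k:ℝ) := by rw [hk]; push_cast; have := Nat.cast_nonneg (α := ℝ) k1; have := Nat.cast_nonneg (α := ℝ) k2; linarith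
  set CG : ℝ := cA⁻¹ ^ (1 / α₁) with hCG
  have hCG0 : 0 < CG := by positivity
  set CU : ℝ := CV * CG ^ d₂ with hCU
  have hCU0 : 0 < CU := by positivity
  set C : ℝ := 1 + cH + CG + CU + cA' with hCdef
  have hC1 : 1 ≤ C := by linarith
  obtain ⟨A, c, c', hA, hc, hc', habs⟩ := aux_abs C k q cl cexl cu cexu hC1 hcl hcexl hcu hcexu
    (levyTail ν) β₂ cw' hcw' (aux_w_meas ν) (fun u hu => (aux_w_pos hcw hpoly u hu).le)
    (fun u v hu huv => aux_w_anti hsub.levy u v hu huv)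
    (fun u R hu huR => aux_w_upper hcw hpoly u R hu huR)
    a b K₁ C₁ K₂ c₂ Cn ha ha1 hb hK₁ hC₁ hK₂ hc₂ hCn
  refine ⟨A, c, c', hA, hc, hc', fun t x y ht hx hy => ?_⟩
  obtain ⟨hφp, hφe⟩ := hφInv t⁻¹ (by positivity)
  set T : ℝ := (φInv t⁻¹)⁻¹ with hT
  have hT0 : 0 < T := by positivity
  have hTi : T⁻¹ = φInv t⁻¹ := by rw [hT, inv_inv]
  have htT : t * laplaceExp ν T⁻¹ = 1 := by rw [hTi, hφe]; field_simp
  have hφT : laplaceExp ν T⁻¹ = t⁻¹ := by rw [hTi, hφe]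
  obtain ⟨hb1, hb2, hb3⟩ := hbf
  set h' : ℝ → ℝ := fun s => if 0 < s then h s x y else 1 with hh'
  have hh's : ∀ s, 0 < s → h' s = h s x y := fun s hs => by simp only [hh', if_pos hs]
  have hh'0 : ∀ s, 0 ≤ h' s := fun s => by
    by_cases hs : 0 < s
    · rw [hh's s hs]; exact (hb1 s x y hs hx hy).1
    · simp only [hh', if_neg hs]; exact zero_le_one
  have hh'1 : ∀ s, h' s ≤ 1 := fun s => by
    by_cases hs : 0 < s
    · rw [hh's s hs]; exact (hb1 s x y hs hx hy).2
    · simp only [hh', if_neg hs]; exact le_rfl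
  have hh'a : Antitone h' := fun s S hsS => by
    by_cases hs : 0 < s
    · rw [hh's s hs, hh's S (hs.trans_le hsS)]; exact hb2 x y hx hy s S hs hsS
    · have : h' s = 1 := by simp only [hh', if_neg hs]
      rw [this]; exact hh'1 S
  set r := dist x y with hr
  have hr0 : 0 ≤ r := dist_nonneg
  have hG : ∀ s, 0 < s → 0 < ΦInv s := fun s hs => (hΦInv s hs).1
  have hV : ∀ s, 0 < s → 0 < vol m x (ΦInv s) := fun s hs => aux_vol_pos m hm x _ (hG s hs)
  have hΨr : 0 ≤ Ψ r := by
    rcases hr0.eq_or_lt with h | h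
    · rw [← h, hΨ0]
    · exact (aux_Phi_pos hΨ0 hΨmono r h).le
  have hC₀0 : 0 ≤ C₀ := by rcases hC₀ with h | h <;> rw [h] <;> norm_num
  have hC₀1 : C₀ ≤ 1 := by rcases hC₀ with h | h <;> rw [h] <;> norm_num
  have hVr : 0 ≤ vol m x r := ENNReal.toReal_nonneg
  have hGsc := fun s S hs hsS => aux_G_scale hΦmono hcA hα₁ hΦsc hΦInv s S hs hsS
  have hker : Ker C k cl cexl cu cexu h' (fun s => (vol m x (ΦInv s))⁻¹) (fun s => (ΦInv s)⁻¹)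
      (fun s => pD s x y) r (C₀ / (vol m x r * Ψ r)) := by
    refine ⟨?_, ?_, ?_, hr0, by positivity, ?_, ?_⟩
    · refine aux_DecF h' C cH γ k hC1 (by linarith) hcH.le hkγ (fun s _ => hh'0 s)
        (fun s S _ h => hh'a h) (fun s S hs hsS => ?_)
      have hS := hs.trans_le hsS
      rw [hh's s hs, hh's S hS]
      have h1 := hb3 x y hx hy s S hs hsS ENNReal.ofReal_lt_top
      have h2 : 0 < s ^ γ := Real.rpow_pos_of_pos hs γ
      rw [Real.div_rpow hS.le hs.le]
      have e : cH * (S ^ γ / s ^ γ) * h S x y = cH * (S ^ γ * h S x y) / s ^ γ := by ring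
      rw [e, le_div_iff₀ h2]
      linarith
    · refine aux_DecF _ C CU (1 / α₁ * d₂) k hC1 (by linarith) hCU0.le hkd
        (fun s hs => (inv_pos.2 (hV s hs)).le) (fun s S hs hsS => ?_) (fun s S hs hsS => ?_)
      · exact inv_anti₀ (hV s hs) (aux_vol_mono m hm x _ _ (hG s hs) (aux_G_mono hΦmono hΦInv s S hs hsS))
      · have hS := hs.trans_le hsS
        have hVs := hV s hs
        have hVS := hV S hS
        have h1 := (hvd x (ΦInv s) (ΦInv S) (hG s hs) (aux_G_mono hΦmono hΦInv s S hs hsS) (by simp)).2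
        have hGs := hG s hs
        have hGS := hG S hS
        have h2 : vol m x (ΦInv S) / vol m x (ΦInv s) ≤ CU * (S / s) ^ (1 / α₁ * d₂) := by
          calc _ ≤ CV * (ΦInv S / ΦInv s) ^ d₂ := h1
            _ ≤ CV * (CG * (S / s) ^ (1 / α₁)) ^ d₂ := by
                gcongr
                exact hGsc s S hs hsS
            _ = CV * (CG ^ d₂ * (S / s) ^ (1 / α₁ * d₂)) := by
                have e : ((S / s) ^ (1 / α₁)) ^ d₂ = (S / s) ^ (1 / α₁ * d₂) :=
                  (Real.rpow_mul (by positivity) _ _).symm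
                rw [Real.mul_rpow hCG0.le (by positivity), e]
            _ = _ := by rw [hCU]; ring
        show (vol m x (ΦInv s))⁻¹ ≤ CU * (S / s) ^ (1 / α₁ * d₂) * (vol m x (ΦInv S))⁻¹
        rw [← div_eq_mul_inv, le_div_iff₀ hVS, inv_mul_eq_div]
        exact h2
    · refine aux_DecF _ C CG (1 / α₁) k hC1 (by linarith) hCG0.le hkα
        (fun s hs => (inv_pos.2 (hG s hs)).le) (fun s S hs hsS => ?_) (fun s S hs hsS => ?_)
      · exact inv_anti₀ (hG s hs) (aux_G_mono hΦmono hΦInv s S hs hsS)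
      · show (ΦInv s)⁻¹ ≤ CG * (S / s) ^ (1 / α₁) * (ΦInv S)⁻¹
        rw [← div_eq_mul_inv, le_div_iff₀ (hG S (hs.trans_le hsS)), inv_mul_eq_div]
        exact hGsc s S hs hsS
    · intro s hs
      have h1 := (hHK s x y hs trivial hx hy).1
      rw [hh's s hs]
      refine le_trans (le_of_eq ?_) h1
      have e1 : C₀ / (vol m x r * Ψ r) * s = C₀ * s / (vol m x r * Ψ r) := by ring
      have e2 : cexl * (r * (ΦInv s)⁻¹) ^ 2 = cexl * r ^ 2 / ΦInv s ^ 2 := by ring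
      beta_reduce
      rw [e1, e2]
    · intro s hs
      have h1 := (hHK s x y hs trivial hx hy).2
      rw [hh's s hs]
      refine le_trans h1 (le_of_eq ?_)
      have e1 : C₀ / (vol m x r * Ψ r) * s = C₀ * s / (vol m x r * Ψ r) := by ring
      have e2 : cexu * (r * (ΦInv s)⁻¹) ^ 2 = cexu * r ^ 2 / ΦInv s ^ 2 := by ring
      beta_reduce
      rw [e1, e2]
  obtain ⟨hi, hii⟩ := habs (μ t) t T h' _ _ _ r _ (hlaw t T ht hT0 htT) ht hT0 hker (hpD_meas x y)
    (fun s => hpD_nonneg s x y) hh'a hh'0 hh'1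
  refine ⟨fun hψ => ?_, fun hψ => ?_⟩
  · have hrT : r * (ΦInv T)⁻¹ ≤ 1 := by
      rw [← div_eq_mul_inv, div_le_one (hG T hT0)]
      rcases hr0.eq_or_lt with h0 | h0
      · rw [← h0]; exact (hG T hT0).le
      by_contra hcon
      push Not at hcon
      have h1 := hΦmono (Set.mem_Ici.2 (hG T hT0).le) (Set.mem_Ici.2 hr0) hcon
      rw [(hΦInv T hT0).2] at h1
      have h2 := aux_phi_strict hsub.levy hcw hpoly (Φ r)⁻¹ T⁻¹ (inv_pos.2 (hT0.trans h1))
        (inv_strictAnti₀ hT0 h1)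
      have h3 := aux_phi_pos hsub.levy hcw hpoly (Φ r)⁻¹ (inv_pos.2 (hT0.trans h1))
      rw [hφT] at h2
      have h4 := inv_strictAnti₀ h3 h2
      rw [inv_inv] at h4
      unfold psiFun at hψ
      linarith
    have := hi hrT
    unfold onDiag subq
    rw [hh's T hT0] at this
    rw [← hT, div_eq_mul_inv]
    exact this
  · have hrpos : 0 < r := by
      rcases hr0.eq_or_lt with h0 | h0
      · rw [← h0] at hψ
        simp only [psiFun, hΦ0, inv_zero, aux_phi_zero] at hψ
        linarith
      · exact h0
    have hR := aux_Phi_pos hΦ0 hΦmono r hrpos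
    have hGR := aux_G_Phi hΦ0 hΦmono hΦInv r hrpos
    have hTR : T ≤ Φ r := by
      by_contra hcon
      push Not at hcon
      have h2 := aux_phi_strict hsub.levy hcw hpoly T⁻¹ (Φ r)⁻¹ (inv_pos.2 hT0) (inv_strictAnti₀ hR hcon)
      rw [hφT] at h2
      have h4 := inv_strictAnti₀ (inv_pos.2 ht) h2
      rw [inv_inv] at h4
      unfold psiFun at hψ
      linarith
    have hVr0 := aux_vol_pos m hm x r hrpos
    have hΨr0 := aux_Phi_pos hΨ0 hΨmono r hrpos
    have := hii (Φ r) hTR (by rw [hGR]; field_simp) (by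
        rw [hGR]
        rw [div_mul_eq_mul_div, div_le_iff₀ (by positivity)]
        have e : (vol m x r)⁻¹ * (vol m x r * Ψ r) = Ψ r := by field_simp
        rw [e]
        have := hΦΨ r hr0
        nlinarith)
      (fun s hs hsR => by
        have h1 : ΦInv s ≤ r := by
          have := aux_G_mono hΦmono hΦInv s (Φ r) hs hsR
          rwa [hGR] at this
        have hGs := hG s hs
        have hy1 : 1 ≤ r * (ΦInv s)⁻¹ := by
          rw [← div_eq_mul_inv, one_le_div hGs]; exact h1
        refine ⟨hy1, ?_⟩
        have h2 := (hΦsc _ _ hGs h1).2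
        rw [(hΦInv s hs).2] at h2
        calc Φ r / s ≤ cA' * (r / ΦInv s) ^ α₂ := h2
          _ ≤ C * (r * (ΦInv s)⁻¹) ^ q := by
            rw [← div_eq_mul_inv] at hy1 ⊢
            rw [← Real.rpow_natCast]
            have g1 := Real.rpow_le_rpow_of_exponent_le hy1 hq
            have g2 : cA' ≤ C := by linarith
            gcongr)
    have hoff : ∀ c : ℝ, offDiag ν m h Φ Ψ ΦInv φInv C₀ c t x y =
        offE (levyTail ν) h' (fun s => (vol m x (ΦInv s))⁻¹) (fun s => (ΦInv s)⁻¹) r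
          (C₀ / (vol m x r * Ψ r)) t T (Φ r) c := fun c => by
      unfold _root_.offDiag offE sB
      have e0 : ∫ s in Set.Ioc (2 * T) (4 * Φ r), h' s * levyTail ν s =
          ∫ s in Set.Ioc (2 * T) (4 * Φ r), h s x y * levyTail ν s := by
        refine setIntegral_congr_fun measurableSet_Ioc fun s hs => ?_
        have hs0 : 0 < s := lt_trans (by positivity) hs.1
        simp only [hh's s hs0]
      have e1 : h T x y / φInv t⁻¹ = T * h T x y := by rw [hT]; ring
      have e2 : c * (r * (ΦInv T)⁻¹) ^ 2 = c * r ^ 2 / ΦInv T ^ 2 := by ring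
      simp only [← hT, ← hr]
      rw [e0, hh's T hT0, hh's (Φ r) hR, e1, e2, hGR, div_eq_mul_inv (h T x y),
        div_eq_mul_inv (h (Φ r) x y * _)]
    rw [hoff, hoff]
    exact this
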